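/- arXiv:1205.6964 — 2 statements merged into one kernel-verified Lean document; each statement's English description precedes it below -/
import Mathlib

section
/- For every nondecreasing function r : ℕ → ℝ with r(n) → ∞ as n → ∞, there exists a probability Borel measure σ on [0,1) that is mutually singular with Lebesgue measure and satisfies σ̂(n) = O(r(|n|) · |n|^{-1/2}) as |n| → ∞. -/
open MeasureTheory Filter Asymptotics

/-- The `n`-th Fourier coefficient of a (finite Borel) measure `μ` on `[0,1)`,
viewed as a measure on the circle `ℝ/ℤ`:  `μ̂(n) = ∫ e^{-2πi n x} dμ(x)`. -/
noncomputable def fourierCoeffM (μ : Measure ℝ) (n : ℤ) : ℂ :=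
  ∫ x, Complex.exp (-(2 * Real.pi * Complex.I * (n : ℂ) * (x : ℂ))) ∂μ

open AddCircle

/-- Trigonometric polynomials of degree at most `d` on the unit circle. -/
noncomputable def trigPoly (d : ℕ) : Submodule ℂ (UnitAddCircle → ℂ) :=
  Submodule.span ℂ ((fun n : ℤ => (fourier n : UnitAddCircle → ℂ)) '' {n | |n| ≤ d})

theorem fourier_mem_trigPoly {d : ℕ} {n : ℤ} (h : |n| ≤ d) :
    (fourier n : UnitAddCircle → ℂ) ∈ trigPoly d :=
  Submodule.subset_span ⟨n, h, rfl⟩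

theorem trigPoly_mono {d e : ℕ} (h : d ≤ e) : trigPoly d ≤ trigPoly e := by
  refine Submodule.span_mono (Set.image_mono fun n hn => ?_)
  simp only [Set.mem_ofPred_eq] at *
  omega

theorem continuous_of_mem_trigPoly {d : ℕ} {f : UnitAddCircle → ℂ} (hf : f ∈ trigPoly d) :
    Continuous f := by
  induction hf using Submodule.span_induction with
  | mem f hf => obtain ⟨n, -, rfl⟩ := hf; exact (fourier n).continuous
  | zero => exact continuous_zero
  | add f g _ _ hf hg => exact hf.add hg
  | smul c f _ hf => exact hf.const_smul c

theorem one_mem_trigPoly (d : ℕ) : (fun _ => 1 : UnitAddCircle → ℂ) ∈ trigPoly d := by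
  convert fourier_mem_trigPoly (d := d) (n := 0) (by simp) using 1
  ext x
  simp

theorem mul_mem_trigPoly {d e : ℕ} {f g : UnitAddCircle → ℂ} (hf : f ∈ trigPoly d)
    (hg : g ∈ trigPoly e) : (fun x => f x * g x) ∈ trigPoly (d + e) := by
  change f * g ∈ _
  induction hf using Submodule.span_induction with
  | zero => simp
  | add f f' _ _ hf hf' => rw [add_mul]; exact add_mem hf hf'
  | smul c f _ hf => rw [smul_mul_assoc]; exact Submodule.smul_mem _ c hf
  | mem f hf =>
    obtain ⟨n, hn, rfl⟩ := hf
    induction hg using Submodule.span_induction with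
    | zero => simp
    | add f f' _ _ hf hf' => rw [mul_add]; exact add_mem hf hf'
    | smul c f _ hf => rw [mul_smul_comm]; exact Submodule.smul_mem _ c hf
    | mem f hf =>
      obtain ⟨m, hm, rfl⟩ := hf
      have : (fourier n : UnitAddCircle → ℂ) * (fourier m : UnitAddCircle → ℂ) =
          fourier (n + m) := by
        ext x; exact fourier_add.symm
      simp only [Set.mem_ofPred_eq] at hn hm
      simp only [this]
      refine fourier_mem_trigPoly ((abs_add_le n m).trans ?_)
      push_cast
      omega

theorem conj_mem_trigPoly {d : ℕ} {f : UnitAddCircle → ℂ} (hf : f ∈ trigPoly d) :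
    (fun x => starRingEnd ℂ (f x)) ∈ trigPoly d := by
  change star f ∈ _
  induction hf using Submodule.span_induction with
  | zero => simp
  | add f f' _ _ hf hf' => rw [star_add]; exact add_mem hf hf'
  | smul c f _ hf => rw [star_smul]; exact Submodule.smul_mem _ _ hf
  | mem f hf =>
    obtain ⟨n, hn, rfl⟩ := hf
    have : star (fourier n : UnitAddCircle → ℂ) = fourier (-n) := by
      ext x; exact fourier_neg.symm
    simp only [this]
    exact fourier_mem_trigPoly (by simpa using hn)

theorem fourierCoeff_add_of_continuous {f g : UnitAddCircle → ℂ} (hf : Continuous f)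
    (hg : Continuous g) (n : ℤ) :
    fourierCoeff (fun x => f x + g x) n = fourierCoeff f n + fourierCoeff g n :=
  congrFun (fourierCoeff.add
    (hf.integrable_of_hasCompactSupport (HasCompactSupport.of_compactSpace _))
    (hg.integrable_of_hasCompactSupport (HasCompactSupport.of_compactSpace _))) n

theorem fourierCoeff_fourier_mul (f : UnitAddCircle → ℂ) (m n : ℤ) :
    fourierCoeff (fun x => fourier m x * f x) n = fourierCoeff f (n - m) := by
  have h : -n + m = -(n - m) := by ring
  simp only [fourierCoeff, smul_eq_mul, ← mul_assoc, ← fourier_add, h]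

theorem fourierCoeff_conj (f : UnitAddCircle → ℂ) (n : ℤ) :
    fourierCoeff (fun x => starRingEnd ℂ (f x)) n = starRingEnd ℂ (fourierCoeff f (-n)) := by
  simp only [fourierCoeff, ← integral_conj, smul_eq_mul, map_mul, ← fourier_neg, neg_neg]

theorem norm_fourierCoeff_mul_le {d : ℕ} {f : UnitAddCircle → ℂ} (hf : f ∈ trigPoly d) :
    ∃ A : ℝ, ∀ (g : UnitAddCircle → ℂ) (n : ℤ) (B : ℝ), Continuous g →
      (∀ m : ℤ, |m| ≤ d → ‖fourierCoeff g (n - m)‖ ≤ B) →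
      ‖fourierCoeff (fun x => f x * g x) n‖ ≤ A * B := by
  induction hf using Submodule.span_induction with
  | zero => exact ⟨0, fun g n B _ _ => by simp [fourierCoeff]⟩
  | mem f hf =>
    obtain ⟨k, hk, rfl⟩ := hf
    refine ⟨1, fun g n B hg h => ?_⟩
    rw [fourierCoeff_fourier_mul, one_mul]
    exact h k hk
  | smul c f _ hf =>
    obtain ⟨A, hA⟩ := hf
    refine ⟨‖c‖ * A, fun g n B hg h => ?_⟩
    simp only [Pi.smul_apply, smul_eq_mul, mul_assoc]
    rw [fourierCoeff.const_mul, norm_mul]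
    exact mul_le_mul_of_nonneg_left (hA g n B hg h) (norm_nonneg c)
  | add f f' hf₁ hf₁' hf hf' =>
    obtain ⟨A, hA⟩ := hf
    obtain ⟨A', hA'⟩ := hf'
    refine ⟨A + A', fun g n B hg h => ?_⟩
    simp only [Pi.add_apply, add_mul]
    have := fourierCoeff_add_of_continuous ((continuous_of_mem_trigPoly hf₁).mul hg)
      ((continuous_of_mem_trigPoly hf₁').mul hg) n
    simp only [Pi.mul_apply] at this
    rw [this]
    exact (norm_add_le _ _).trans (add_le_add (hA g n B hg h) (hA' g n B hg h))

theorem fourierCoeff_eq_zero_of_mem_trigPoly {d : ℕ} {f : UnitAddCircle → ℂ}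
    (hf : f ∈ trigPoly d) {n : ℤ} (hn : d < |n|) : fourierCoeff f n = 0 := by
  induction hf using Submodule.span_induction with
  | zero => simp [fourierCoeff]
  | mem f hf =>
    obtain ⟨k, hk, rfl⟩ := hf
    rw [fourierCoeff_fourier, Pi.single_apply, if_neg]
    rintro rfl
    exact hn.not_ge hk
  | smul c f _ hf => simp [fourierCoeff.const_smul, hf]
  | add f f' hf₁ hf₁' hf hf' =>
    have := fourierCoeff_add_of_continuous (continuous_of_mem_trigPoly hf₁)
      (continuous_of_mem_trigPoly hf₁') n
    rw [hf, hf', add_zero] at this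
    exact this

theorem exists_trigPoly_near (f : C(UnitAddCircle, ℂ)) {ε : ℝ} (hε : 0 < ε) :
    ∃ d : ℕ, ∃ p ∈ trigPoly d, ∀ x, ‖p x - f x‖ ≤ ε := by
  have hf : f ∈ closure (Submodule.span ℂ (Set.range (@fourier (1 : ℝ))) : Set _) := by
    have := span_fourier_closure_eq_top (T := (1 : ℝ))
    rw [← Submodule.topologicalClosure_coe, this]
    trivial
  obtain ⟨p, hp, hpf⟩ := Metric.mem_closure_iff.1 hf ε hε
  have key : ∀ p ∈ Submodule.span ℂ (Set.range (@fourier (1 : ℝ))),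
      ∃ d : ℕ, (p : UnitAddCircle → ℂ) ∈ trigPoly d := by
    intro p hp
    induction hp using Submodule.span_induction with
    | zero => exact ⟨0, by simp⟩
    | mem f hf =>
      obtain ⟨k, rfl⟩ := hf
      exact ⟨k.natAbs, fourier_mem_trigPoly (by simp)⟩
    | smul c f _ hf =>
      obtain ⟨d, hd⟩ := hf
      exact ⟨d, by simpa using Submodule.smul_mem _ c hd⟩
    | add f g _ _ hf hg =>
      obtain ⟨d, hd⟩ := hf
      obtain ⟨e, he⟩ := hg
      refine ⟨max d e, ?_⟩
      simpa using add_mem (trigPoly_mono (le_max_left d e) hd)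
        (trigPoly_mono (le_max_right d e) he)
  obtain ⟨d, hd⟩ := key p hp
  refine ⟨d, p, hd, fun x => ?_⟩
  rw [dist_comm, dist_eq_norm] at hpf
  exact ((p - f).norm_coe_le_norm x).trans hpf.le

/-- The pair of Rudin-Shapiro polynomials of degree less than `2 ^ n`. -/
noncomputable def rudinShapiro : ℕ → (UnitAddCircle → ℂ) × (UnitAddCircle → ℂ)
  | 0 => (fun _ => 1, fun _ => 1)
  | n + 1 =>
    (fun x => (rudinShapiro n).1 x + fourier (2 ^ n) x * (rudinShapiro n).2 x,
     fun x => (rudinShapiro n).1 x + -1 * (fourier (2 ^ n) x * (rudinShapiro n).2 x))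

theorem norm_fourier_apply (n : ℤ) (x : UnitAddCircle) : ‖fourier n x‖ = 1 := by
  rw [fourier_apply, Circle.norm_coe]

theorem rudinShapiro_norm_sq (n : ℕ) (x : UnitAddCircle) :
    ‖(rudinShapiro n).1 x‖ ^ 2 + ‖(rudinShapiro n).2 x‖ ^ 2 = 2 ^ (n + 1) := by
  induction n with
  | zero => norm_num [rudinShapiro]
  | succ n ih =>
    have h := parallelogram_law_with_norm ℝ ((rudinShapiro n).1 x)
      (fourier (2 ^ n) x * (rudinShapiro n).2 x)
    rw [norm_mul, norm_fourier_apply, one_mul] at h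
    simp only [rudinShapiro, neg_one_mul, ← sub_eq_add_neg]
    rw [pow_succ _ (n + 1), ← ih]
    linarith

theorem rudinShapiro_mem_trigPoly (n : ℕ) :
    (rudinShapiro n).1 ∈ trigPoly (2 ^ n) ∧ (rudinShapiro n).2 ∈ trigPoly (2 ^ n) := by
  induction n with
  | zero => exact ⟨one_mem_trigPoly _, one_mem_trigPoly _⟩
  | succ n ih =>
    have h1 := trigPoly_mono (Nat.pow_le_pow_right two_pos n.le_succ) ih.1
    have h2 : (fun x => fourier (2 ^ n) x * (rudinShapiro n).2 x) ∈ trigPoly (2 ^ (n + 1)) := by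
      rw [pow_succ, mul_two]
      exact mul_mem_trigPoly (fourier_mem_trigPoly (by simp)) ih.2
    exact ⟨add_mem h1 h2, add_mem h1 (Submodule.smul_mem _ (-1) h2)⟩

/-- All Fourier coefficients of `f` have norm at most `1` and only the ones with index in
`[a, b)` can be nonzero. -/
def SpectrumBoundedIn (a b : ℤ) (f : UnitAddCircle → ℂ) : Prop :=
  ∀ m, ‖fourierCoeff f m‖ ≤ 1 ∧ ((m < a ∨ b ≤ m) → fourierCoeff f m = 0)

theorem SpectrumBoundedIn.fourier_mul {a b : ℤ} {f : UnitAddCircle → ℂ}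
    (h : SpectrumBoundedIn a b f) (k : ℤ) :
    SpectrumBoundedIn (k + a) (k + b) (fun x => fourier k x * f x) := by
  intro m
  rw [fourierCoeff_fourier_mul]
  exact ⟨(h _).1, fun hm => (h _).2 (by omega)⟩

theorem SpectrumBoundedIn.neg_one_mul {a b : ℤ} {f : UnitAddCircle → ℂ}
    (h : SpectrumBoundedIn a b f) : SpectrumBoundedIn a b (fun x => -1 * f x) := by
  intro m
  rw [fourierCoeff.const_mul, norm_mul, norm_neg, norm_one, one_mul]
  exact ⟨(h m).1, fun hm => by rw [(h m).2 hm, mul_zero]⟩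

theorem SpectrumBoundedIn.add {a b c : ℤ} {f g : UnitAddCircle → ℂ} (hab : a ≤ b) (hbc : b ≤ c)
    (hfc : Continuous f) (hgc : Continuous g)
    (hf : SpectrumBoundedIn a b f) (hg : SpectrumBoundedIn b c g) :
    SpectrumBoundedIn a c (fun x => f x + g x) := by
  intro m
  rw [fourierCoeff_add_of_continuous hfc hgc]
  refine ⟨?_, fun hm => ?_⟩
  · rcases lt_or_ge m b with hm | hm
    · rw [(hg m).2 (Or.inl hm), add_zero]
      exact (hf m).1
    · rw [(hf m).2 (Or.inr hm), zero_add]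
      exact (hg m).1
  · rw [(hf m).2 (by omega), (hg m).2 (by omega), add_zero]

theorem rudinShapiro_spectrum (n : ℕ) :
    SpectrumBoundedIn 0 (2 ^ n) (rudinShapiro n).1 ∧
      SpectrumBoundedIn 0 (2 ^ n) (rudinShapiro n).2 := by
  induction n with
  | zero =>
    have : SpectrumBoundedIn 0 (2 ^ 0) (fun _ => 1) := by
      have h1 : (fun _ => 1 : UnitAddCircle → ℂ) = fourier 0 := by ext x; simp
      intro m
      rw [h1, fourierCoeff_fourier, Pi.single_apply]
      split_ifs with h
      · simp [h]
      · simp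
    exact ⟨this, this⟩
  | succ n ih =>
    obtain ⟨h1, h2⟩ := rudinShapiro_mem_trigPoly n
    have c1 := continuous_of_mem_trigPoly h1
    have c2 := (fourier (2 ^ n)).continuous.mul (continuous_of_mem_trigPoly h2)
    have h : SpectrumBoundedIn (2 ^ n) (2 ^ (n + 1))
        (fun x => fourier (2 ^ n) x * (rudinShapiro n).2 x) := by
      have := ih.2.fourier_mul (2 ^ n)
      rwa [add_zero, ← mul_two, ← pow_succ] at this
    have p1 : (0 : ℤ) ≤ 2 ^ n := by positivity
    have p2 : (2 : ℤ) ^ n ≤ 2 ^ (n + 1) := by rw [pow_succ]; omega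
    exact ⟨ih.1.add p1 p2 c1 c2 h, ih.1.add p1 p2 c1 (continuous_const.mul c2) h.neg_one_mul⟩

/-- A real function whose Fourier coefficients are supported in `N ≤ |m| ≤ 2 * N` and have size
at most `1 / √N`. -/
structure IsFlatBlock (N : ℕ) (g : UnitAddCircle → ℝ) : Prop where
  mem : (fun x => (g x : ℂ)) ∈ trigPoly (2 * N)
  coeff_le : ∀ m, ‖fourierCoeff (fun x => (g x : ℂ)) m‖ ≤ (√N)⁻¹
  coeff_eq_zero : ∀ m : ℤ, |m| < N → fourierCoeff (fun x => (g x : ℂ)) m = 0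

theorem isFlatBlock_of_spectrum {N : ℕ} {f : UnitAddCircle → ℂ} (hf : f ∈ trigPoly N)
    (hs : SpectrumBoundedIn 0 N f) {c : ℂ} (hc : ‖c‖ ≤ (√N)⁻¹) :
    IsFlatBlock N (fun x => (c * (fourier N x * f x)).re) := by
  have hF : (fun x => fourier N x * f x) ∈ trigPoly (2 * N) := by
    rw [two_mul]
    exact mul_mem_trigPoly (fourier_mem_trigPoly (by simp)) hf
  have hS := hs.fourier_mul N
  rw [add_zero] at hS
  set F := fun x => fourier N x * f x with hFdef
  have hcF : (fun x => c * F x) ∈ trigPoly (2 * N) := Submodule.smul_mem _ c hF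
  have hre : (fun x => (((c * F x).re : ℝ) : ℂ)) =
      fun x => (1 / 2 : ℂ) * (c * F x + starRingEnd ℂ (c * F x)) := by
    ext x
    rw [Complex.add_conj]
    push_cast
    ring
  have hcoeff : ∀ m, fourierCoeff (fun x => (((c * F x).re : ℝ) : ℂ)) m =
      1 / 2 * (c * fourierCoeff F m + starRingEnd ℂ (c * fourierCoeff F (-m))) := by
    intro m
    have hcont := continuous_of_mem_trigPoly hcF
    have hadd := fourierCoeff_add_of_continuous hcont (Complex.continuous_conj.comp hcont) m
    simp only [Function.comp_apply] at hadd
    rw [hre, fourierCoeff.const_mul, hadd, fourierCoeff.const_mul]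
    congr 2
    exact (fourierCoeff_conj _ m).trans (by rw [fourierCoeff.const_mul])
  refine ⟨?_, fun m => ?_, fun m hm => ?_⟩
  · change (fun x => (((c * F x).re : ℝ) : ℂ)) ∈ _
    rw [hre]
    exact Submodule.smul_mem _ _ (add_mem hcF (conj_mem_trigPoly hcF))
  · change ‖fourierCoeff (fun x => (((c * F x).re : ℝ) : ℂ)) m‖ ≤ _
    have b : ∀ k, ‖c * fourierCoeff F k‖ ≤ (√N)⁻¹ := fun k => by
      rw [norm_mul]
      exact (mul_le_of_le_one_right (norm_nonneg c) (hS k).1).trans hc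
    rw [hcoeff, norm_mul]
    have := (norm_add_le (c * fourierCoeff F m) (starRingEnd ℂ (c * fourierCoeff F (-m)))).trans
      (add_le_add (b m) ((RCLike.norm_conj _).le.trans (b (-m))))
    have h2 : ‖(1 / 2 : ℂ)‖ = 1 / 2 := by norm_num
    rw [h2]
    linarith
  · change fourierCoeff (fun x => (((c * F x).re : ℝ) : ℂ)) m = 0
    rw [abs_lt] at hm
    rw [hcoeff, (hS m).2 (by omega), (hS (-m)).2 (by omega)]
    simp

theorem IsFlatBlock.neg {N : ℕ} {g : UnitAddCircle → ℝ} (h : IsFlatBlock N g) :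
    IsFlatBlock N (fun x => -g x) := by
  have h1 : (fun x => ((-g x : ℝ) : ℂ)) = fun x => (-1 : ℂ) * (g x : ℂ) := by
    ext x; push_cast; ring
  refine ⟨?_, fun m => ?_, fun m hm => ?_⟩
  · rw [h1]
    exact Submodule.smul_mem _ (-1) h.mem
  · rw [h1, fourierCoeff.const_mul, norm_mul, norm_neg, norm_one, one_mul]
    exact h.coeff_le m
  · rw [h1, fourierCoeff.const_mul, h.coeff_eq_zero m hm, mul_zero]

theorem exists_isFlatBlock_sum_sq_eq_one (n : ℕ) :
    ∃ g : Fin 4 → UnitAddCircle → ℝ, (∀ i, IsFlatBlock (2 ^ n) (g i)) ∧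
      ∀ x, ∑ i, g i x ^ 2 = 1 := by
  obtain ⟨h1, h2⟩ := rudinShapiro_mem_trigPoly n
  obtain ⟨s1, s2⟩ := rudinShapiro_spectrum n
  set c : ℝ := (√(2 ^ (n + 1)))⁻¹ with hc
  have hc0 : 0 ≤ c := by positivity
  have hcle : c ≤ (√((2 ^ n : ℕ) : ℝ))⁻¹ := by
    refine inv_anti₀ (by positivity) (Real.sqrt_le_sqrt ?_)
    push_cast
    exact pow_le_pow_right₀ one_le_two n.le_succ
  have n1 : ‖(c : ℂ)‖ ≤ (√((2 ^ n : ℕ) : ℝ))⁻¹ := by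
    rwa [Complex.norm_real, Real.norm_of_nonneg hc0]
  have n2 : ‖(c * -Complex.I : ℂ)‖ ≤ (√((2 ^ n : ℕ) : ℝ))⁻¹ := by
    rwa [norm_mul, norm_neg, Complex.norm_I, mul_one]
  have key := fun (f : UnitAddCircle → ℂ) hf (hs : SpectrumBoundedIn 0 (2 ^ n : ℕ) f) (c : ℂ) =>
    isFlatBlock_of_spectrum (N := 2 ^ n) hf hs (c := c)
  set F := fun x => fourier (2 ^ n : ℕ) x * (rudinShapiro n).1 x with hF
  set G := fun x => fourier (2 ^ n : ℕ) x * (rudinShapiro n).2 x with hG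
  refine ⟨![fun x => (c * F x).re, fun x => (c * -Complex.I * F x).re,
    fun x => (c * G x).re, fun x => (c * -Complex.I * G x).re], ?_, ?_⟩
  · intro i
    fin_cases i
    · exact key _ h1 (by exact_mod_cast s1) _ n1
    · exact key _ h1 (by exact_mod_cast s1) _ n2
    · exact key _ h2 (by exact_mod_cast s2) _ n1
    · exact key _ h2 (by exact_mod_cast s2) _ n2
  · intro x
    have aux : ∀ z : ℂ, ((c : ℂ) * z).re ^ 2 + ((c * -Complex.I : ℂ) * z).re ^ 2 =
        c ^ 2 * ‖z‖ ^ 2 := by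
      intro z
      rw [← Complex.normSq_eq_norm_sq, Complex.normSq_apply]
      simp
      ring
    have hc2 : c ^ 2 * 2 ^ (n + 1) = 1 := by
      rw [hc, inv_pow, Real.sq_sqrt (by positivity)]
      exact inv_mul_cancel₀ (by positivity)
    simp only [Fin.sum_univ_four, Matrix.cons_val]
    have a1 := aux (F x)
    have a2 := aux (G x)
    have m1 : ‖F x‖ = ‖(rudinShapiro n).1 x‖ := by
      rw [hF, norm_mul, norm_fourier_apply, one_mul]
    have m2 : ‖G x‖ = ‖(rudinShapiro n).2 x‖ := by
      rw [hG, norm_mul, norm_fourier_apply, one_mul]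
    rw [m1] at a1
    rw [m2] at a2
    have := rudinShapiro_norm_sq n x
    rw [← hc2, ← this]
    linarith

theorem Continuous.integrable_haarAddCircle {E : Type*} [NormedAddCommGroup E]
    {f : UnitAddCircle → E} (hf : Continuous f) :
    Integrable f (haarAddCircle : Measure UnitAddCircle) :=
  hf.integrable_of_hasCompactSupport (HasCompactSupport.of_compactSpace _)

theorem integral_haarAddCircle_pos {f : UnitAddCircle → ℝ} (hf : Continuous f)
    (hpos : ∀ x, 0 < f x) : 0 < ∫ x, f x ∂haarAddCircle := by
  rw [integral_pos_iff_support_of_nonneg (fun x => (hpos x).le) hf.integrable_haarAddCircle]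
  have : Function.support f = Set.univ := Set.eq_univ_of_forall fun x => (hpos x).ne'
  simp [this]

theorem continuous_of_ofReal_mem_trigPoly {d : ℕ} {P : UnitAddCircle → ℝ}
    (h : (fun x => (P x : ℂ)) ∈ trigPoly d) : Continuous P :=
  Complex.continuous_re.comp (continuous_of_mem_trigPoly h)

theorem Real.sqrt_one_add_le_sub_sq {t : ℝ} (h1 : |t| ≤ 1) :
    √(1 + t) ≤ 1 + t / 2 - t ^ 2 / 16 := by
  obtain ⟨h2, h3⟩ := abs_le.1 h1
  rw [Real.sqrt_le_left (by nlinarith)]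
  nlinarith [mul_nonneg (sq_nonneg t) (sub_nonneg.2 h3), sq_nonneg (t ^ 2)]

theorem IsFlatBlock.continuous {N : ℕ} {g : UnitAddCircle → ℝ} (h : IsFlatBlock N g) :
    Continuous g :=
  continuous_of_ofReal_mem_trigPoly h.mem

theorem integral_sqrt_mul_one_add_le {P g : UnitAddCircle → ℝ} (hP : Continuous P)
    (hpos : ∀ x, 0 < P x) (hg : Continuous g) (hg1 : ∀ x, |g x| ≤ 1)
    (h1 : ∫ x, √(P x) * g x ∂haarAddCircle ≤ 0)
    (h2 : (∫ x, √(P x) ∂haarAddCircle) / 4 ≤ ∫ x, √(P x) * g x ^ 2 ∂haarAddCircle) :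
    ∫ x, √(P x * (1 + g x / 2)) ∂haarAddCircle ≤
      255 / 256 * ∫ x, √(P x) ∂haarAddCircle := by
  have hs : Continuous fun x => √(P x) := hP.sqrt
  have i1 : Integrable (fun x => √(P x)) (haarAddCircle : Measure UnitAddCircle) :=
    hs.integrable_haarAddCircle
  have i2 : Integrable (fun x => √(P x) * g x / 4) (haarAddCircle : Measure UnitAddCircle) :=
    ((hs.mul hg).div_const 4).integrable_haarAddCircle
  have i3 : Integrable (fun x => √(P x) * g x ^ 2 / 64) (haarAddCircle : Measure UnitAddCircle) :=
    ((hs.mul (hg.pow 2)).div_const 64).integrable_haarAddCircle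
  calc ∫ x, √(P x * (1 + g x / 2)) ∂haarAddCircle
      ≤ ∫ x, (√(P x) + √(P x) * g x / 4 - √(P x) * g x ^ 2 / 64) ∂haarAddCircle := by
        refine integral_mono ?_ ((i1.add i2).sub i3) fun x => ?_
        · refine Continuous.integrable_haarAddCircle ?_
          fun_prop
        · have hx : |g x / 2| ≤ 1 := by
            rw [abs_div, abs_two]
            linarith [hg1 x]
          change √(P x * (1 + g x / 2)) ≤ _
          rw [Real.sqrt_mul (hpos x).le]
          have := mul_le_mul_of_nonneg_left (Real.sqrt_one_add_le_sub_sq hx)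
            (Real.sqrt_nonneg (P x))
          refine this.trans (le_of_eq ?_)
          ring
    _ = ∫ x, √(P x) ∂haarAddCircle + (∫ x, √(P x) * g x ∂haarAddCircle) / 4 -
          (∫ x, √(P x) * g x ^ 2 ∂haarAddCircle) / 64 := by
        have i12 : Integrable (fun x => √(P x) + √(P x) * g x / 4)
            (haarAddCircle : Measure UnitAddCircle) := i1.add i2
        rw [integral_sub i12 i3, integral_add i1 i2, integral_div, integral_div]
    _ ≤ _ := by linarith

theorem exists_isFlatBlock_integral_sqrt_le {P : UnitAddCircle → ℝ} (hP : Continuous P)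
    (hpos : ∀ x, 0 < P x) (n : ℕ) :
    ∃ g, IsFlatBlock (2 ^ n) g ∧ (∀ x, |g x| ≤ 1) ∧
      ∫ x, √(P x * (1 + g x / 2)) ∂haarAddCircle ≤
        255 / 256 * ∫ x, √(P x) ∂haarAddCircle := by
  obtain ⟨g, hg, hsum⟩ := exists_isFlatBlock_sum_sq_eq_one n
  have hs : Continuous fun x => √(P x) := hP.sqrt
  have htot : ∑ i, ∫ x, √(P x) * g i x ^ 2 ∂haarAddCircle = ∫ x, √(P x) ∂haarAddCircle := by
    have hi : ∀ i ∈ Finset.univ, Integrable (fun x => √(P x) * g i x ^ 2)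
        (haarAddCircle : Measure UnitAddCircle) := fun i _ =>
      (hs.mul ((hg i).continuous.pow 2)).integrable_haarAddCircle
    rw [← integral_finsetSum _ hi]
    simp_rw [← Finset.mul_sum, hsum, mul_one]
  obtain ⟨i, -, hi⟩ : ∃ i ∈ Finset.univ, (∫ x, √(P x) ∂haarAddCircle) / 4 ≤
      ∫ x, √(P x) * g i x ^ 2 ∂haarAddCircle := by
    refine Finset.exists_le_of_sum_le Finset.univ_nonempty ?_
    rw [htot, Finset.sum_const, Finset.card_univ, Fintype.card_fin, nsmul_eq_mul]
    push_cast
    linarith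
  have hg1 : ∀ x, |g i x| ≤ 1 := fun x => by
    rw [← sq_le_one_iff_abs_le_one, ← hsum x]
    exact Finset.single_le_sum (f := fun j => g j x ^ 2) (fun j _ => sq_nonneg _)
      (Finset.mem_univ i)
  rcases le_total (∫ x, √(P x) * g i x ∂haarAddCircle) 0 with h | h
  · exact ⟨g i, hg i, hg1, integral_sqrt_mul_one_add_le hP hpos (hg i).continuous hg1 h hi⟩
  · refine ⟨_, (hg i).neg, fun x => by simpa using hg1 x, integral_sqrt_mul_one_add_le hP hpos
      (hg i).neg.continuous (fun x => by simpa using hg1 x) ?_ (by simpa using hi)⟩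
    simp_rw [mul_neg, integral_neg]
    linarith

/-- A positive trigonometric polynomial of integral one, of degree at most `D`, whose Fourier
coefficients obey the prescribed bound and such that `1 / √P` is well approximated by a
trigonometric polynomial of degree at most `D`. -/
structure IsRieszDensity (r : ℕ → ℝ) (P : UnitAddCircle → ℝ) (D : ℕ) : Prop where
  pos : ∀ x, 0 < P x
  mem : (fun x => (P x : ℂ)) ∈ trigPoly D
  integral_eq_one : ∫ x, P x ∂haarAddCircle = 1
  coeff : ∀ n : ℤ, n ≠ 0 → fourierCoeff (fun x => (P x : ℂ)) n = 0 ∨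
    ‖fourierCoeff (fun x => (P x : ℂ)) n‖ ≤ r n.natAbs * |(n : ℝ)| ^ (-(1 / 2) : ℝ)
  approx : ∃ q ∈ trigPoly D, ∀ x, ‖q x - ((√(P x))⁻¹ : ℝ)‖ ≤ ∫ x, √(P x) ∂haarAddCircle

theorem exists_trigPoly_near_inv_sqrt {P : UnitAddCircle → ℝ} (hP : Continuous P)
    (hpos : ∀ x, 0 < P x) :
    ∃ D, ∃ q ∈ trigPoly D, ∀ x, ‖q x - ((√(P x))⁻¹ : ℝ)‖ ≤ ∫ x, √(P x) ∂haarAddCircle := by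
  have hs : Continuous fun x => √(P x) := hP.sqrt
  have hs0 : ∀ x, 0 < √(P x) := fun x => Real.sqrt_pos.2 (hpos x)
  exact exists_trigPoly_near ⟨fun x => (((√(P x))⁻¹ : ℝ) : ℂ),
    Complex.continuous_ofReal.comp (hs.inv₀ fun x => (hs0 x).ne')⟩
    (integral_haarAddCircle_pos hs hs0)

theorem exists_isRieszDensity_one (r : ℕ → ℝ) : ∃ D, IsRieszDensity r (fun _ => 1) D := by
  obtain ⟨D, q, hq, h⟩ := exists_trigPoly_near_inv_sqrt (P := fun _ => 1) continuous_const
    fun _ => one_pos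
  refine ⟨D, fun _ => one_pos, ?_, by simp, fun n hn => Or.inl ?_, q, hq, h⟩
  · simpa using one_mem_trigPoly D
  · refine fourierCoeff_eq_zero_of_mem_trigPoly (d := 0) (by simpa using one_mem_trigPoly 0) ?_
    simpa using hn

theorem IsFlatBlock.fourierCoeff_mul_eq_zero {N d : ℕ} {g : UnitAddCircle → ℝ}
    (hg : IsFlatBlock N g) {f : UnitAddCircle → ℂ} (hf : f ∈ trigPoly d) {n : ℤ}
    (hn : |n| + d < N) : fourierCoeff (fun x => f x * g x) n = 0 := by
  obtain ⟨A, hA⟩ := norm_fourierCoeff_mul_le hf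
  have := hA _ n 0 (continuous_of_mem_trigPoly hg.mem) fun m hm => by
    rw [hg.coeff_eq_zero, norm_zero]
    exact (abs_sub n m).trans_lt (by omega)
  simpa using this

theorem fourierCoeff_zero_eq_integral (f : UnitAddCircle → ℂ) :
    fourierCoeff f 0 = ∫ x, f x ∂haarAddCircle := by
  simp [fourierCoeff]

theorem inv_sqrt_le_two_mul_rpow {N : ℕ} {a : ℝ} (ha : 0 < a) (hN : a ≤ 4 * N) :
    (√N)⁻¹ ≤ 2 * a ^ (-(1 / 2) : ℝ) := by
  have hN0 : (0 : ℝ) < N := by linarith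
  rw [Real.rpow_neg ha.le, ← Real.sqrt_eq_rpow, ← div_eq_mul_inv, inv_eq_one_div,
    div_le_div_iff₀ (Real.sqrt_pos.2 hN0) (Real.sqrt_pos.2 ha), one_mul]
  have : √(4 * N) = 2 * √N := by
    rw [Real.sqrt_mul (by norm_num), show (4 : ℝ) = 2 ^ 2 by norm_num, Real.sqrt_sq two_pos.le]
  rw [← this]
  exact Real.sqrt_le_sqrt hN

theorem IsRieszDensity.exists_next {r : ℕ → ℝ} (hmono : Monotone r) (hr : Tendsto r atTop atTop)
    {P : UnitAddCircle → ℝ} {D : ℕ} (h : IsRieszDensity r P D) :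
    ∃ P' D', IsRieszDensity r P' D' ∧ D < D' ∧
      ∫ x, √(P' x) ∂haarAddCircle ≤ 255 / 256 * ∫ x, √(P x) ∂haarAddCircle ∧
      ∀ q ∈ trigPoly D, ∫ x, q x * (P' x : ℂ) ∂haarAddCircle =
        ∫ x, q x * (P x : ℂ) ∂haarAddCircle := by
  have hPc := continuous_of_ofReal_mem_trigPoly h.mem
  obtain ⟨A, hA⟩ := norm_fourierCoeff_mul_le h.mem
  obtain ⟨K, hK⟩ := (hr.eventually_ge_atTop |A|).exists
  obtain ⟨N, ⟨n, hn⟩, hN⟩ : ∃ N, (∃ n, N = 2 ^ n) ∧ K + 2 * D < N :=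
    ⟨_, ⟨_, rfl⟩, Nat.lt_two_pow_self⟩
  obtain ⟨g, hg, hg1, hint⟩ := exists_isFlatBlock_integral_sqrt_le hPc h.pos n
  rw [← hn] at hg
  set P' : UnitAddCircle → ℝ := fun x => P x * (1 + g x / 2) with hP'
  have hPg : (fun x => (P x : ℂ) * (g x : ℂ)) ∈ trigPoly (D + 2 * N) :=
    mul_mem_trigPoly h.mem hg.mem
  have hP'eq : (fun x => (P' x : ℂ)) =
      fun x => (P x : ℂ) + 1 / 2 * ((P x : ℂ) * (g x : ℂ)) := by
    ext x
    simp only [hP']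
    push_cast
    ring
  have hmem : (fun x => (P' x : ℂ)) ∈ trigPoly (D + 2 * N) := by
    rw [hP'eq]
    exact add_mem (trigPoly_mono (by omega) h.mem) (Submodule.smul_mem _ (1 / 2 : ℂ) hPg)
  have hpos : ∀ x, 0 < P' x := fun x =>
    mul_pos (h.pos x) (by linarith [(abs_le.1 (hg1 x)).1])
  have hP'c := continuous_of_ofReal_mem_trigPoly hmem
  obtain ⟨E, q, hq, happrox⟩ := exists_trigPoly_near_inv_sqrt hP'c hpos
  have hinv : ∀ q ∈ trigPoly D, ∫ x, q x * (P' x : ℂ) ∂haarAddCircle =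
      ∫ x, q x * (P x : ℂ) ∂haarAddCircle := by
    intro q hq
    have hqc := continuous_of_mem_trigPoly hq
    have h0 := hg.fourierCoeff_mul_eq_zero (mul_mem_trigPoly hq h.mem) (n := 0)
      (by push_cast; simp; omega)
    have e : (fun x => q x * (P' x : ℂ)) =
        fun x => q x * (P x : ℂ) + 1 / 2 * (q x * (P x : ℂ) * (g x : ℂ)) := by
      ext x
      rw [congrFun hP'eq x]
      ring
    have hc := continuous_of_mem_trigPoly h.mem
    have hgc := continuous_of_mem_trigPoly hg.mem
    have i1 : Integrable (fun x => q x * (P x : ℂ)) (haarAddCircle : Measure UnitAddCircle) :=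
      (hqc.mul hc).integrable_haarAddCircle
    have i2 : Integrable (fun x => 1 / 2 * (q x * (P x : ℂ) * (g x : ℂ)))
        (haarAddCircle : Measure UnitAddCircle) :=
      (continuous_const.mul ((hqc.mul hc).mul hgc)).integrable_haarAddCircle
    rw [e, integral_add i1 i2, integral_const_mul,
      ← fourierCoeff_zero_eq_integral (fun x => q x * (P x : ℂ) * (g x : ℂ)), h0]
    simp
  refine ⟨P', max (D + 2 * N) E, ⟨hpos, trigPoly_mono (le_max_left _ _) hmem, ?_, ?_, q,
    trigPoly_mono (le_max_right _ _) hq, happrox⟩,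
    lt_of_lt_of_le (by omega) (le_max_left _ _), hint, hinv⟩
  · have := hinv _ (one_mem_trigPoly D)
    simp only [one_mul] at this
    rw [integral_complex_ofReal, integral_complex_ofReal, h.integral_eq_one] at this
    exact_mod_cast this
  · intro m hm
    have hc := continuous_of_mem_trigPoly h.mem
    have hgc := continuous_of_mem_trigPoly hg.mem
    have hcoeff : fourierCoeff (fun x => (P' x : ℂ)) m = fourierCoeff (fun x => (P x : ℂ)) m +
        1 / 2 * fourierCoeff (fun x => (P x : ℂ) * (g x : ℂ)) m := by
      rw [hP'eq, ← fourierCoeff.const_mul]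
      exact fourierCoeff_add_of_continuous hc (continuous_const.mul (hc.mul hgc)) m
    rcases le_or_gt |m| (D : ℤ) with hmD | hmD
    · rw [hcoeff, hg.fourierCoeff_mul_eq_zero h.mem (by omega), mul_zero, add_zero]
      exact h.coeff m hm
    · rw [hcoeff, fourierCoeff_eq_zero_of_mem_trigPoly h.mem hmD, zero_add]
      rcases lt_or_ge (|m| + D) (N : ℤ) with h1 | h1
      · left
        rw [hg.fourierCoeff_mul_eq_zero h.mem h1, mul_zero]
      rcases lt_or_ge ((D + 2 * N : ℕ) : ℤ) |m| with h2 | h2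
      · left
        rw [fourierCoeff_eq_zero_of_mem_trigPoly hPg h2, mul_zero]
      right
      have hm0 : 0 < |(m : ℝ)| := abs_pos.2 (by exact_mod_cast hm)
      have hmN : |(m : ℝ)| ≤ 4 * N := by
        have : |m| ≤ 4 * N := by push_cast at h2; omega
        exact_mod_cast this
      have hKm : |A| ≤ r m.natAbs := hK.trans (hmono (by
        have := Int.natCast_natAbs m
        omega))
      have hb := hA _ m _ hgc fun k _ => hg.coeff_le (m - k)
      rw [norm_mul, show ‖(1 / 2 : ℂ)‖ = 1 / 2 by norm_num]
      have hs := inv_sqrt_le_two_mul_rpow hm0 hmN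
      have hs0 : (0 : ℝ) ≤ (√N)⁻¹ := by positivity
      have hr0 : 0 ≤ |(m : ℝ)| ^ (-(1 / 2) : ℝ) := by positivity
      have b1 : A * (√N)⁻¹ ≤ |A| * (√N)⁻¹ := mul_le_mul_of_nonneg_right (le_abs_self A) hs0
      have b2 := mul_le_mul_of_nonneg_left hs (abs_nonneg A)
      have b3 := mul_le_mul_of_nonneg_right hKm hr0
      linarith

theorem mutuallySingular_of_tsum_lintegral {α : Type*} [MeasurableSpace α] {μ ν : Measure α}
    {f : ℕ → α → ℝ} (hf : ∀ k, Measurable (f k)) (hpos : ∀ k x, 0 < f k x)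
    (h1 : ∑' k, ∫⁻ x, ENNReal.ofReal (f k x) ∂μ ≠ ⊤)
    (h2 : ∑' k, ∫⁻ x, ENNReal.ofReal (f k x)⁻¹ ∂ν ≠ ⊤) : μ ⟂ₘ ν := by
  have m1 : ∀ k, Measurable fun x => ENNReal.ofReal (f k x) := fun k => (hf k).ennreal_ofReal
  have m2 : ∀ k, Measurable fun x => ENNReal.ofReal (f k x)⁻¹ := fun k =>
    (hf k).inv.ennreal_ofReal
  rw [← lintegral_tsum fun k => (m1 k).aemeasurable] at h1
  rw [← lintegral_tsum fun k => (m2 k).aemeasurable] at h2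
  have a1 := ae_lt_top (.tsum m1) h1
  have a2 := ae_lt_top (.tsum m2) h2
  refine Measure.MutuallySingular.mk (s := {x | ¬ ∑' k, ENNReal.ofReal (f k x) < ⊤})
    (t := {x | ¬ ∑' k, ENNReal.ofReal (f k x)⁻¹ < ⊤}) a1 a2 fun x _ => ?_
  by_contra hx
  simp only [Set.mem_union, Set.mem_ofPred_eq, not_or, not_not] at hx
  have e1 := (ENNReal.tendsto_atTop_zero_of_tsum_ne_top hx.1.ne).eventually_lt_const one_pos
  have e2 := (ENNReal.tendsto_atTop_zero_of_tsum_ne_top hx.2.ne).eventually_lt_const one_pos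
  obtain ⟨k, h1, h2⟩ := (e1.and e2).exists
  rw [ENNReal.ofReal_lt_one] at h1 h2
  exact lt_asymm h2 ((one_lt_inv₀ (hpos k x)).2 h1)

theorem exists_isRieszDensity_seq {r : ℕ → ℝ} (hmono : Monotone r)
    (hr : Tendsto r atTop atTop) :
    ∃ (P : ℕ → UnitAddCircle → ℝ) (D : ℕ → ℕ), (∀ k, IsRieszDensity r (P k) (D k)) ∧
      StrictMono D ∧ (∀ k, ∫ x, √(P k x) ∂haarAddCircle ≤ (255 / 256) ^ k) ∧
      ∀ k l, k ≤ l → ∀ q ∈ trigPoly (D k), ∫ x, q x * (P l x : ℂ) ∂haarAddCircle =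
        ∫ x, q x * (P k x : ℂ) ∂haarAddCircle := by
  obtain ⟨D₀, h₀⟩ := exists_isRieszDensity_one r
  let S := {p : (UnitAddCircle → ℝ) × ℕ // IsRieszDensity r p.1 p.2}
  have step : ∀ s : S, ∃ s' : S, s.1.2 < s'.1.2 ∧
      ∫ x, √(s'.1.1 x) ∂haarAddCircle ≤ 255 / 256 * ∫ x, √(s.1.1 x) ∂haarAddCircle ∧
      ∀ q ∈ trigPoly s.1.2, ∫ x, q x * (s'.1.1 x : ℂ) ∂haarAddCircle =
        ∫ x, q x * (s.1.1 x : ℂ) ∂haarAddCircle := fun s => by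
    obtain ⟨P', D', h, h'⟩ := s.2.exists_next hmono hr
    exact ⟨⟨(P', D'), h⟩, h'⟩
  choose F hF using step
  let s : ℕ → S := fun k => F^[k] ⟨(_, D₀), h₀⟩
  have hs : ∀ k, s (k + 1) = F (s k) := fun k => Function.iterate_succ_apply' F k _
  have hD : StrictMono fun k => (s k).1.2 := strictMono_nat_of_lt_succ fun k => by
    rw [hs]
    exact (hF (s k)).1
  refine ⟨fun k => (s k).1.1, fun k => (s k).1.2, fun k => (s k).2, hD, fun k => ?_,
    fun k l hkl => ?_⟩
  · induction k with
    | zero => simp [s]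
    | succ k ih =>
      beta_reduce at ih ⊢
      rw [hs, pow_succ']
      exact (hF (s k)).2.1.trans (mul_le_mul_of_nonneg_left ih (by norm_num))
  · induction l, hkl using Nat.le_induction with
    | base => exact fun q _ => rfl
    | succ l hkl ih =>
      intro q hq
      beta_reduce at ih hq ⊢
      rw [hs, (hF (s l)).2.2 q (trigPoly_mono (hD.monotone hkl) hq), ih q hq]

theorem exists_probabilityMeasure_integral_eq {r : ℕ → ℝ} {P : ℕ → UnitAddCircle → ℝ}
    {D : ℕ → ℕ} (hP : ∀ k, IsRieszDensity r (P k) (D k))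
    (hinv : ∀ k l, k ≤ l → ∀ q ∈ trigPoly (D k), ∫ x, q x * (P l x : ℂ) ∂haarAddCircle =
        ∫ x, q x * (P k x : ℂ) ∂haarAddCircle) :
    ∃ σ : ProbabilityMeasure UnitAddCircle, ∀ k, ∀ q ∈ trigPoly (D k),
      ∫ x, q x ∂(σ : Measure UnitAddCircle) = ∫ x, q x * (P k x : ℂ) ∂haarAddCircle := by
  have hc : ∀ k, Continuous (P k) := fun k => continuous_of_ofReal_mem_trigPoly (hP k).mem
  let ν : ℕ → ProbabilityMeasure UnitAddCircle := fun k =>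
    ⟨haarAddCircle.withDensity fun x => ENNReal.ofReal (P k x), ⟨by
      rw [withDensity_apply _ MeasurableSet.univ, Measure.restrict_univ,
        ← ofReal_integral_eq_lintegral_ofReal (hc k).integrable_haarAddCircle
          (.of_forall fun x => ((hP k).pos x).le), (hP k).integral_eq_one, ENNReal.ofReal_one]⟩⟩
  have hν : ∀ k (q : UnitAddCircle → ℂ), ∫ x, q x ∂(ν k : Measure UnitAddCircle) =
      ∫ x, q x * (P k x : ℂ) ∂haarAddCircle := fun k q => by
    change ∫ x, q x ∂(haarAddCircle.withDensity fun x => ENNReal.ofReal (P k x)) = _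
    rw [integral_withDensity_eq_integral_toReal_smul (hc k).measurable.ennreal_ofReal
      (.of_forall fun x => ENNReal.ofReal_lt_top)]
    refine integral_congr_ae (.of_forall fun x => ?_)
    simp only [ENNReal.toReal_ofReal ((hP k).pos x).le, Complex.real_smul]
    ring
  obtain ⟨σ, hσ⟩ : ∃ σ, MapClusterPt σ atTop ν := exists_clusterPt_of_compactSpace _
  rw [mapClusterPt_iff_ultrafilter] at hσ
  obtain ⟨U, hU, hσ⟩ := hσ
  refine ⟨σ, fun k q hq => ?_⟩
  have hlim := (ProbabilityMeasure.tendsto_iff_forall_integral_rclike_tendsto ℂ).1 hσ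
    (BoundedContinuousFunction.mkOfCompact ⟨q, continuous_of_mem_trigPoly hq⟩)
  refine tendsto_nhds_unique hlim (tendsto_const_nhds.congr' ?_)
  filter_upwards [hU (eventually_ge_atTop k)] with l hl
  simp only [BoundedContinuousFunction.mkOfCompact_apply, ContinuousMap.coe_mk]
  rw [hν, hinv k l hl q hq]

theorem IsRieszDensity.integral_inv_sqrt_le {r : ℕ → ℝ} {P : UnitAddCircle → ℝ} {D : ℕ}
    (h : IsRieszDensity r P D) (σ : Measure UnitAddCircle) [IsProbabilityMeasure σ]
    (hσ : ∀ q ∈ trigPoly D, ∫ x, q x ∂σ = ∫ x, q x * (P x : ℂ) ∂haarAddCircle) :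
    ∫ x, (√(P x))⁻¹ ∂σ ≤ 3 * ∫ x, √(P x) ∂haarAddCircle := by
  obtain ⟨q, hq, hqP⟩ := h.approx
  set ε := ∫ x, √(P x) ∂haarAddCircle with hε
  have hPc := continuous_of_ofReal_mem_trigPoly h.mem
  have hqre : Continuous fun x => (q x).re :=
    Complex.continuous_re.comp (continuous_of_mem_trigPoly hq)
  have hic : Continuous fun x => (√(P x))⁻¹ :=
    hPc.sqrt.inv₀ fun x => (Real.sqrt_pos.2 (h.pos x)).ne'
  have hre : ∀ x, |(q x).re - (√(P x))⁻¹| ≤ ε := fun x => by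
    have := (Complex.abs_re_le_norm (q x - ((√(P x))⁻¹ : ℝ))).trans (hqP x)
    rwa [Complex.sub_re, Complex.ofReal_re] at this
  have hint : ∀ (μ : Measure UnitAddCircle) [IsProbabilityMeasure μ] {f : UnitAddCircle → ℝ},
      Continuous f → Integrable f μ := fun μ _ f hf =>
    hf.integrable_of_hasCompactSupport (HasCompactSupport.of_compactSpace _)
  have e1 : ∫ x, (q x).re ∂σ = ∫ x, (q x).re * P x ∂haarAddCircle := by
    have hq1 : Integrable q σ := (continuous_of_mem_trigPoly hq).integrable_of_hasCompactSupport
      (HasCompactSupport.of_compactSpace _)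
    have hq2 : Integrable (fun x => q x * (P x : ℂ)) haarAddCircle :=
      ((continuous_of_mem_trigPoly hq).mul
        (continuous_of_mem_trigPoly h.mem)).integrable_haarAddCircle
    have := congrArg Complex.re (hσ q hq)
    rw [← RCLike.re_eq_complex_re, ← integral_re hq1, ← integral_re hq2] at this
    simpa using this
  calc ∫ x, (√(P x))⁻¹ ∂σ ≤ ∫ x, ((q x).re + ε) ∂σ :=
        integral_mono (hint σ hic) (hint σ (hqre.add continuous_const)) fun x => by
          have := (abs_le.1 (hre x)).1
          change (√(P x))⁻¹ ≤ (q x).re + ε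
          linarith
    _ = ∫ x, (q x).re * P x ∂haarAddCircle + ε := by
        rw [integral_add (hint σ hqre) (integrable_const _), e1]
        simp
    _ ≤ ∫ x, (√(P x) + ε * P x) ∂haarAddCircle + ε := by
        refine add_le_add_left (integral_mono (hint _ (hqre.mul hPc))
          (hint _ (hPc.sqrt.add (continuous_const.mul hPc))) fun x => ?_) _
        have h1 := mul_le_mul_of_nonneg_right (sub_le_iff_le_add.1 (abs_le.1 (hre x)).2)
          (h.pos x).le
        have h2 : (√(P x))⁻¹ * P x = √(P x) := by
          rw [inv_mul_eq_div, Real.div_sqrt]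
        change (q x).re * P x ≤ √(P x) + ε * P x
        linarith
    _ = 3 * ε := by
        have i1 : Integrable (fun x => √(P x)) (haarAddCircle : Measure UnitAddCircle) :=
          hint _ hPc.sqrt
        have i2 : Integrable (fun x => ε * P x) (haarAddCircle : Measure UnitAddCircle) :=
          hint _ (continuous_const.mul hPc)
        rw [integral_add i1 i2, integral_const_mul, h.integral_eq_one, ← hε]
        ring

theorem exists_singular_measure_unitAddCircle {r : ℕ → ℝ} (hmono : Monotone r)
    (hr : Tendsto r atTop atTop) :
    ∃ σ : ProbabilityMeasure UnitAddCircle,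
      (σ : Measure UnitAddCircle) ⟂ₘ (haarAddCircle : Measure UnitAddCircle) ∧
      ∀ n : ℤ, n ≠ 0 → ∫ x, fourier (-n) x ∂(σ : Measure UnitAddCircle) = 0 ∨
        ‖∫ x, fourier (-n) x ∂(σ : Measure UnitAddCircle)‖ ≤
          r n.natAbs * |(n : ℝ)| ^ (-(1 / 2) : ℝ) := by
  obtain ⟨P, D, hP, hD, hdecay, hinv⟩ := exists_isRieszDensity_seq hmono hr
  obtain ⟨σ, hσ⟩ := exists_probabilityMeasure_integral_eq hP hinv
  have hs0 : ∀ k x, 0 < √(P k x) := fun k x => Real.sqrt_pos.2 ((hP k).pos x)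
  have hsc : ∀ k, Continuous fun x => √(P k x) := fun k =>
    (continuous_of_ofReal_mem_trigPoly (hP k).mem).sqrt
  have hic : ∀ k, Continuous fun x => (√(P k x))⁻¹ := fun k =>
    (hsc k).inv₀ fun x => (hs0 k x).ne'
  have hgeom : Summable fun k : ℕ => (255 / 256 : ℝ) ^ k :=
    summable_geometric_of_lt_one (by norm_num) (by norm_num)
  refine ⟨σ, mutuallySingular_of_tsum_lintegral (fun k => (hic k).measurable)
    (fun k x => inv_pos.2 (hs0 k x)) ?_ ?_, fun n hn => ?_⟩
  · refine ne_top_of_le_ne_top (hgeom.mul_left 3).tsum_ofReal_ne_top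
      (ENNReal.tsum_le_tsum fun k => ?_)
    rw [← ofReal_integral_eq_lintegral_ofReal
      ((hic k).integrable_of_hasCompactSupport (HasCompactSupport.of_compactSpace _))
      (.of_forall fun x => (inv_pos.2 (hs0 k x)).le)]
    exact ENNReal.ofReal_le_ofReal (((hP k).integral_inv_sqrt_le σ (hσ k)).trans
      (mul_le_mul_of_nonneg_left (hdecay k) (by norm_num)))
  · refine ne_top_of_le_ne_top hgeom.tsum_ofReal_ne_top (ENNReal.tsum_le_tsum fun k => ?_)
    simp_rw [inv_inv]
    rw [← ofReal_integral_eq_lintegral_ofReal (hsc k).integrable_haarAddCircle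
      (.of_forall fun x => (hs0 k x).le)]
    exact ENNReal.ofReal_le_ofReal (hdecay k)
  · have hmem : (fourier (-n) : UnitAddCircle → ℂ) ∈ trigPoly (D n.natAbs) := by
      refine fourier_mem_trigPoly ?_
      rw [abs_neg, ← Int.natCast_natAbs]
      exact_mod_cast hD.le_apply
    rw [hσ _ _ hmem]
    exact (hP n.natAbs).coeff n hn

/-- (Schaeffer) For every nondecreasing `r : ℕ → ℝ` with `r(n) → ∞` there exists a
probability Borel measure `σ` on `[0,1)` mutually singular with Lebesgue measure and
satisfying `σ̂(n) = O(r(|n|) · |n|^{-1/2})` as `|n| → ∞`. -/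
theorem stmt_15 (r : ℕ → ℝ) (hmono : Monotone r)
    (hr : Tendsto r atTop atTop) :
    ∃ σ : Measure ℝ, IsProbabilityMeasure σ ∧
      σ (Set.Ico (0:ℝ) 1)ᶜ = 0 ∧
      σ ⟂ₘ (MeasureTheory.volume.restrict (Set.Ico (0:ℝ) 1)) ∧
      (fun n : ℤ => fourierCoeffM σ n) =O[cofinite]
        (fun n : ℤ => r n.natAbs * (|n| : ℝ) ^ (-(1/2) : ℝ)) := by
  obtain ⟨σ, hsing, hσ⟩ := exists_singular_measure_unitAddCircle hmono hr
  let φ : UnitAddCircle → ℝ := fun x => (AddCircle.measurableEquivIco 1 0 x : ℝ)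
  have hφ : Measurable φ :=
    measurable_subtype_coe.comp (AddCircle.measurableEquivIco 1 0).measurable
  have hφc : ∀ x, (φ x : UnitAddCircle) = x := fun x => AddCircle.coe_equivIco
  have hφI : ∀ x, φ x ∈ Set.Ico (0 : ℝ) 1 := fun x => by
    have := (AddCircle.measurableEquivIco (1 : ℝ) 0 x).2
    exact ⟨this.1, this.2.trans_eq (zero_add 1)⟩
  refine ⟨(σ : Measure UnitAddCircle).map φ, Measure.isProbabilityMeasure_map hφ.aemeasurable,
    ?_, ?_, ?_⟩
  · rw [Measure.map_apply hφ measurableSet_Ico.compl, measure_eq_zero_iff_ae_notMem]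
    exact .of_forall fun x hx => hx (hφI x)
  · obtain ⟨s, hs, h1, h2⟩ := hsing
    have hmk := UnitAddCircle.measurePreserving_mk 0
    rw [zero_add] at hmk
    have hvol : (volume : Measure UnitAddCircle) = haarAddCircle := by
      rw [volume_eq_smul_haarAddCircle, ENNReal.ofReal_one, one_smul]
    refine ⟨(fun x : ℝ => (x : UnitAddCircle)) ⁻¹' s, hmk.measurable hs, ?_, ?_⟩
    · rw [Measure.map_apply hφ (hmk.measurable hs), ← Set.preimage_comp]
      convert h1
      ext x
      simp [hφc]
    · rw [restrict_Ico_eq_restrict_Ioc, ← Set.preimage_compl, hmk.measure_preimage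
        hs.compl.nullMeasurableSet, hvol, h2]
  · have hcoeff : ∀ n : ℤ, fourierCoeffM ((σ : Measure UnitAddCircle).map φ) n =
        ∫ x, fourier (-n) x ∂(σ : Measure UnitAddCircle) := fun n => by
      rw [fourierCoeffM, integral_map hφ.aemeasurable (by fun_prop)]
      refine integral_congr_ae (.of_forall fun x => ?_)
      simp only
      conv_rhs => rw [← hφc x]
      rw [fourier_coe_apply]
      congr 1
      push_cast
      ring
    refine IsBigO.of_bound 1 ?_
    have hnat : Tendsto Int.natAbs cofinite atTop := by
      rw [← Nat.cofinite_eq_atTop]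
      refine Tendsto.cofinite_of_finite_preimage_singleton fun b => ?_
      refine (Set.finite_Icc (-(b : ℤ)) b).subset fun n hn => ?_
      simp only [Set.mem_preimage, Set.mem_singleton_iff] at hn
      simp only [Set.mem_Icc]
      omega
    filter_upwards [(hr.comp hnat).eventually_ge_atTop 0,
      (Set.finite_singleton (0 : ℤ)).compl_mem_cofinite] with n hn hn0
    rw [Function.comp_apply] at hn
    rw [one_mul, hcoeff, Real.norm_of_nonneg (mul_nonneg hn (by positivity))]
    rcases hσ n hn0 with h | h
    · rw [h, norm_zero]
      exact mul_nonneg hn (by positivity)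
    · exact h
end

section
/- There exists a probability Borel measure σ on [0,1) that is mutually singular with Lebesgue measure and satisfies σ̂(n) = O(|n|^{-1/2+ε}) as |n| → ∞ for every ε > 0 (a Schaeffer–Salem measure). -/
open MeasureTheory Filter Asymptotics

namespace SchaefferSalem

open scoped ComplexConjugate
open AddCircle

/-- The circle `ℝ/ℤ`. -/
local notation "𝕋" => AddCircle (1 : ℝ)

/-- The `n`-th Fourier coefficient, as a linear functional on continuous functions. -/
noncomputable def coeff (n : ℤ) : C(𝕋, ℂ) →ₗ[ℂ] ℂ where
  toFun f := ∫ x, (fourier (-n) * f : C(𝕋, ℂ)) x ∂haarAddCircle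
  map_add' f g := by
    rw [← integral_add]
    · simp [mul_add]
    · exact (fourier (-n) * f : C(𝕋, ℂ)).continuous.integrable_of_hasCompactSupport
        (HasCompactSupport.of_compactSpace _)
    · exact (fourier (-n) * g : C(𝕋, ℂ)).continuous.integrable_of_hasCompactSupport
        (HasCompactSupport.of_compactSpace _)
  map_smul' c f := by
    simp [← integral_const_mul, mul_left_comm]

lemma coeff_apply (n : ℤ) (f : C(𝕋, ℂ)) :
    coeff n f = ∫ x, (fourier (-n) * f : C(𝕋, ℂ)) x ∂haarAddCircle := rfl

lemma two_apply (x : 𝕋) : (2 : C(𝕋, ℂ)) x = 2 := rfl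

lemma fourier_mul_fourier (m n : ℤ) :
    (fourier m * fourier n : C(𝕋, ℂ)) = fourier (m + n) := by
  ext x
  simp

lemma fourier_zero_eq_one : (fourier 0 : C(𝕋, ℂ)) = 1 := by
  ext x
  simp

lemma star_fourier (n : ℤ) : star (fourier n : C(𝕋, ℂ)) = fourier (-n) := by
  ext x
  simp

lemma coeff_fourier (n k : ℤ) : coeff n (fourier k) = if k = n then 1 else 0 := by
  have h : coeff n (fourier k) = fourierCoeff (fourier k : C(𝕋, ℂ)) n := by
    simp [coeff_apply, fourierCoeff]
  rw [h, fourierCoeff_fourier]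
  simp [Pi.single_apply, eq_comm]

lemma coeff_fourier_mul (n k : ℤ) (f : C(𝕋, ℂ)) :
    coeff n (fourier k * f) = coeff (n - k) f := by
  rw [coeff_apply, coeff_apply, ← mul_assoc, fourier_mul_fourier]
  congr 3
  ring_nf

lemma coeff_star (n : ℤ) (f : C(𝕋, ℂ)) : coeff n (star f) = conj (coeff (-n) f) := by
  rw [coeff_apply, coeff_apply, ← integral_conj]
  simp

/-- The trigonometric polynomials with spectrum in `S`. -/
noncomputable def trigSpan (S : Set ℤ) : Submodule ℂ C(𝕋, ℂ) :=
  Submodule.span ℂ ((fun n : ℤ => (fourier n : C(𝕋, ℂ))) '' S)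

variable {S S' R : Set ℤ} {f g : C(𝕋, ℂ)}

lemma fourier_mem_trigSpan {n : ℤ} (hn : n ∈ S) : (fourier n : C(𝕋, ℂ)) ∈ trigSpan S :=
  Submodule.subset_span ⟨n, hn, rfl⟩

lemma one_mem_trigSpan (h : 0 ∈ S) : 1 ∈ trigSpan S :=
  fourier_zero_eq_one ▸ fourier_mem_trigSpan h

lemma trigSpan_mono (h : S ⊆ R) (hf : f ∈ trigSpan S) : f ∈ trigSpan R :=
  Submodule.span_mono (Set.image_mono h) hf

lemma mul_mem_trigSpan (hf : f ∈ trigSpan S) (hg : g ∈ trigSpan S')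
    (h : ∀ a ∈ S, ∀ b ∈ S', a + b ∈ R) : f * g ∈ trigSpan R := by
  have := Submodule.mul_mem_mul hf hg
  rw [trigSpan, trigSpan, Submodule.span_mul_span] at this
  refine Submodule.span_mono ?_ this
  rintro _ ⟨_, ⟨a, ha, rfl⟩, _, ⟨b, hb, rfl⟩, rfl⟩
  exact ⟨a + b, h a ha b hb, (fourier_mul_fourier a b).symm⟩

lemma star_mem_trigSpan (hf : f ∈ trigSpan S) (h : ∀ a ∈ S, -a ∈ R) :
    star f ∈ trigSpan R := by
  induction hf using Submodule.span_induction with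
  | mem x hx =>
    obtain ⟨a, ha, rfl⟩ := hx
    simpa only [star_fourier] using fourier_mem_trigSpan (h a ha)
  | zero => simp
  | add x y _ _ hx hy => simpa only [star_add] using add_mem hx hy
  | smul c x _ hx => simpa only [star_smul] using Submodule.smul_mem _ _ hx

lemma coeff_eq_zero_of_mem_trigSpan (hf : f ∈ trigSpan S) {n : ℤ} (hn : n ∉ S) :
    coeff n f = 0 := by
  have : trigSpan S ≤ LinearMap.ker (coeff n) := by
    rw [trigSpan, Submodule.span_le]
    rintro _ ⟨a, ha, rfl⟩
    have : a ≠ n := fun h => hn (h ▸ ha)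
    simp [coeff_fourier, this]
  exact this hf

/-- Trigonometric polynomials whose spectra are never opposite are orthogonal. -/
lemma coeff_zero_mul_eq_zero (hf : f ∈ trigSpan S) (hg : g ∈ trigSpan S')
    (h : ∀ a ∈ S, ∀ b ∈ S', a + b ≠ 0) : coeff 0 (f * g) = 0 :=
  coeff_eq_zero_of_mem_trigSpan (mul_mem_trigSpan (R := {0}ᶜ) hf hg h) (by simp)

lemma eq_sum_of_mem_trigSpan (s : Finset ℤ) (hf : f ∈ trigSpan s) :
    f = ∑ k ∈ s, coeff k f • (fourier k : C(𝕋, ℂ)) := by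
  ext x
  simp only [ContinuousMap.sum_apply, ContinuousMap.smul_apply, smul_eq_mul]
  induction hf using Submodule.span_induction with
  | mem y hy =>
    obtain ⟨a, ha, rfl⟩ := hy
    have ha : a ∈ s := ha
    simp [coeff_fourier, ha, -fourier_apply]
  | zero => simp
  | add y z _ _ hy hz => simp [add_mul, Finset.sum_add_distrib, ← hy, ← hz, -fourier_apply]
  | smul c y _ hy => simp [mul_assoc, ← Finset.mul_sum, ← hy, -fourier_apply]

lemma norm_coeff_mul_le (s : Finset ℤ) (hf : f ∈ trigSpan s) (hf1 : ∀ n, ‖coeff n f‖ ≤ 1)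
    {δ : ℝ} (hg : ∀ n, ‖coeff n g‖ ≤ δ) (n : ℤ) : ‖coeff n (f * g)‖ ≤ s.card * δ := by
  rw [eq_sum_of_mem_trigSpan s hf, Finset.sum_mul, map_sum]
  refine (norm_sum_le_of_le s (f := fun k => _) (n := fun _ => δ) fun k _ => ?_).trans (by simp)
  rw [smul_mul_assoc, map_smul, coeff_fourier_mul, norm_smul]
  exact (mul_le_of_le_one_left (norm_nonneg _) (hf1 k)).trans (hg _)

/-- The pair of Rudin–Shapiro polynomials with `2 ^ m` terms. -/
noncomputable def rudinShapiro : ℕ → C(𝕋, ℂ) × C(𝕋, ℂ)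
  | 0 => (1, 1)
  | m + 1 => ((rudinShapiro m).1 + fourier (2 ^ m) * (rudinShapiro m).2,
      (rudinShapiro m).1 - fourier (2 ^ m) * (rudinShapiro m).2)

lemma fourier_mul_star_fourier (n : ℤ) :
    (fourier n : C(𝕋, ℂ)) * star (fourier n) = 1 := by
  rw [star_fourier, fourier_mul_fourier, add_neg_cancel, fourier_zero_eq_one]

lemma rudinShapiro_mul_star (m : ℕ) :
    (rudinShapiro m).1 * star (rudinShapiro m).1 + (rudinShapiro m).2 * star (rudinShapiro m).2
      = 2 * 2 ^ m := by
  induction m with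
  | zero => simp [rudinShapiro, one_add_one_eq_two]
  | succ m ih =>
    simp only [rudinShapiro, star_add, star_sub, star_mul]
    linear_combination 2 * ih + 2 * (rudinShapiro m).2 * star (rudinShapiro m).2 *
      fourier_mul_star_fourier (2 ^ m)

lemma rudinShapiro_mem (m : ℕ) :
    (rudinShapiro m).1 ∈ trigSpan (Set.Ico 0 (2 ^ m)) ∧
      (rudinShapiro m).2 ∈ trigSpan (Set.Ico 0 (2 ^ m)) := by
  induction m with
  | zero => simpa [rudinShapiro] using one_mem_trigSpan (by simp)
  | succ m ih =>
    have h1 : (rudinShapiro m).1 ∈ trigSpan (Set.Ico 0 (2 ^ (m + 1))) :=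
      trigSpan_mono (Set.Ico_subset_Ico_right (by gcongr <;> simp)) ih.1
    have h2 : fourier (2 ^ m) * (rudinShapiro m).2 ∈ trigSpan (Set.Ico 0 (2 ^ (m + 1))) := by
      refine mul_mem_trigSpan (fourier_mem_trigSpan (Set.mem_singleton _)) ih.2 ?_
      simp only [Set.mem_singleton_iff, Set.mem_Ico, forall_eq, pow_succ]
      intro b hb
      constructor <;> linarith
    exact ⟨add_mem h1 h2, sub_mem h1 h2⟩

/-- Coefficients stay bounded under sums with disjoint spectra. -/
lemma norm_coeff_add_le {δ : ℝ} (hf : f ∈ trigSpan S) (hg : g ∈ trigSpan S')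
    (h : Disjoint S S') (hf1 : ∀ n, ‖coeff n f‖ ≤ δ) (hg1 : ∀ n, ‖coeff n g‖ ≤ δ) (n : ℤ) :
    ‖coeff n (f + g)‖ ≤ δ := by
  by_cases hn : n ∈ S
  · simpa [coeff_eq_zero_of_mem_trigSpan hg (h.notMem_of_mem_left hn)] using hf1 n
  · simpa [coeff_eq_zero_of_mem_trigSpan hf hn] using hg1 n

lemma fourier_mul_mem_trigSpan (k a b : ℤ) (hf : f ∈ trigSpan (Set.Ico a b)) :
    fourier k * f ∈ trigSpan (Set.Ico (k + a) (k + b)) := by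
  refine mul_mem_trigSpan (fourier_mem_trigSpan (Set.mem_singleton _)) hf ?_
  simp +contextual

lemma norm_coeff_rudinShapiro_le (m : ℕ) :
    (∀ n, ‖coeff n (rudinShapiro m).1‖ ≤ 1) ∧ ∀ n, ‖coeff n (rudinShapiro m).2‖ ≤ 1 := by
  induction m with
  | zero =>
    have (n : ℤ) : ‖coeff n 1‖ ≤ 1 := by
      rw [← fourier_zero_eq_one, coeff_fourier]
      split_ifs <;> simp
    exact ⟨this, this⟩
  | succ m ih =>
    have hP := (rudinShapiro_mem m).1
    have hQ := fourier_mul_mem_trigSpan (2 ^ m) _ _ (rudinShapiro_mem m).2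
    have hdisj : Disjoint (Set.Ico (0 : ℤ) (2 ^ m)) (Set.Ico (2 ^ m + 0) (2 ^ m + 2 ^ m)) := by
      simp [Set.disjoint_left]
      intros
      linarith
    refine ⟨norm_coeff_add_le hP hQ hdisj ih.1 fun n => ?_, ?_⟩
    · rw [coeff_fourier_mul]
      exact ih.2 _
    · simp only [rudinShapiro, sub_eq_add_neg]
      refine norm_coeff_add_le hP (neg_mem hQ) hdisj ih.1 fun n => ?_
      rw [map_neg, norm_neg, coeff_fourier_mul]
      exact ih.2 _

/-- A real trigonometric polynomial with spectrum in `±[N, 4N]`, `N = 2 ^ m`, which is bounded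
by one, has flat coefficients, and whose square equals `1 / 4` up to frequencies at least `N`. -/
lemma exists_flat_block (m : ℕ) : ∃ g : C(𝕋, ℂ), star g = g ∧ (∀ x, ‖g x‖ ≤ 1) ∧
    g ∈ trigSpan {n | 2 ^ m ≤ |n| ∧ |n| ≤ 4 * 2 ^ m} ∧
    g * g - (1 / 4 : ℂ) • 1 ∈ trigSpan {n | 2 ^ m ≤ |n|} ∧
    ∀ n, ‖coeff n g‖ ≤ 1 / √(2 ^ m) := by
  set P := (rudinShapiro m).1 with hP
  set Q := (rudinShapiro m).2 with hQ
  set N : ℤ := 2 ^ m with hN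
  have hN0 : 0 < N := by positivity
  obtain ⟨memP, memQ⟩ := rudinShapiro_mem m
  obtain ⟨cP, cQ⟩ := norm_coeff_rudinShapiro_le m
  have hPQ := rudinShapiro_mul_star m
  rw [← hP, ← hQ] at *
  rw [← hN] at memP memQ
  set A := fourier N * P with hA
  set B := fourier (3 * N) * Q with hB
  set G := A + B with hG
  have memA : A ∈ trigSpan (Set.Ico (N + 0) (N + N)) := fourier_mul_mem_trigSpan _ _ _ memP
  have memB : B ∈ trigSpan (Set.Ico (3 * N + 0) (3 * N + N)) := fourier_mul_mem_trigSpan _ _ _ memQ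
  have memG : G ∈ trigSpan (Set.Ico N (4 * N)) :=
    add_mem (trigSpan_mono (Set.Ico_subset_Ico (by linarith) (by linarith)) memA)
      (trigSpan_mono (Set.Ico_subset_Ico (by linarith) (by linarith)) memB)
  have cG (n : ℤ) : ‖coeff n G‖ ≤ 1 := by
    refine norm_coeff_add_le memA memB ?_ (fun n => ?_) (fun n => ?_) n
    · simp [Set.disjoint_left]
      intros
      linarith
    · rw [hA, coeff_fourier_mul]
      exact cP _
    · rw [hB, coeff_fourier_mul]
      exact cQ _
  have hAB : A * star A + B * star B = 2 * 2 ^ m := by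
    simp only [hA, hB, star_mul]
    linear_combination hPQ + P * star P * fourier_mul_star_fourier N +
      Q * star Q * fourier_mul_star_fourier (3 * N)
  set s : ℝ := √(2 ^ m) with hs
  have hs0 : 0 < s := by positivity
  have hs2 : s ^ 2 = 2 ^ m := Real.sq_sqrt (by positivity)
  have nG (x : 𝕋) : ‖G x‖ ≤ 2 * s := by
    have h1 := congrArg (fun f : C(𝕋, ℂ) => (f x).re) hAB
    have h2 : ‖A x‖ ^ 2 + ‖B x‖ ^ 2 = 2 * s ^ 2 := by
      rw [hs2]
      have e : (2 * 2 ^ m : C(𝕋, ℂ)) x = ((2 * 2 ^ m : ℝ) : ℂ) := by simp [two_apply]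
      simp only [e, Complex.ofReal_re] at h1
      rw [← h1]
      simp [Complex.sq_norm, Complex.normSq_apply]
    have h3 : ‖G x‖ ≤ ‖A x‖ + ‖B x‖ := norm_add_le _ _
    nlinarith [sq_nonneg (‖A x‖ - ‖B x‖)]
  have memG' : star G ∈ trigSpan (Set.Ioc (-(4 * N)) (-N)) :=
    star_mem_trigSpan memG (by simp; intros; constructor <;> linarith)
  set c : ℂ := ((1 / (4 * s) : ℝ) : ℂ) with hc
  have hc2 : c ^ 2 * (4 * 2 ^ m) = 1 / 4 := by
    have : (1 / (4 * s)) ^ 2 * (4 * 2 ^ m) = (1 / 4 : ℝ) := by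
      rw [← hs2]
      field_simp
    rw [hc]
    simpa using congrArg Complex.ofReal this
  have nc : ‖c‖ = 1 / (4 * s) := by
    rw [hc, Complex.norm_real, Real.norm_of_nonneg (by positivity)]
  refine ⟨c • (G + star G), ?_, fun x => ?_, ?_, ?_, fun n => ?_⟩
  · simp [hc, add_comm]
  · have h3 : ‖G x + star (G x)‖ ≤ 2 * s + 2 * s :=
      (norm_add_le _ _).trans (add_le_add (nG x) (by simpa using nG x))
    calc ‖(c • (G + star G)) x‖ = ‖c‖ * ‖G x + star (G x)‖ := by simp
      _ ≤ 1 / (4 * s) * (2 * s + 2 * s) := by rw [nc]; gcongr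
      _ = 1 := by field_simp; norm_num
  · refine Submodule.smul_mem _ _ (add_mem (trigSpan_mono ?_ memG) (trigSpan_mono ?_ memG'))
    · intro n ⟨h1, h2⟩
      rw [Set.mem_ofPred_eq, abs_of_pos (by linarith)]
      exact ⟨h1, h2.le⟩
    · intro n ⟨h1, h2⟩
      rw [Set.mem_ofPred_eq, abs_of_neg (by linarith)]
      constructor <;> linarith
  · have key : c • (G + star G) * c • (G + star G) - (1 / 4 : ℂ) • 1
        = c ^ 2 • (G * G + star G * star G + (2 : ℂ) • (B * star A) + (2 : ℂ) • (A * star B)) := by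
      ext x
      have h1 := congrArg (fun f : C(𝕋, ℂ) => f x) hAB
      simp only [ContinuousMap.add_apply, ContinuousMap.mul_apply, ContinuousMap.star_apply,
        ContinuousMap.pow_apply, two_apply] at h1
      simp only [hG, ContinuousMap.sub_apply, ContinuousMap.smul_apply, ContinuousMap.add_apply,
        ContinuousMap.mul_apply, ContinuousMap.star_apply, smul_eq_mul, ContinuousMap.one_apply,
        star_add, ← hc2]
      linear_combination 2 * c ^ 2 * h1
    rw [key]
    have memA' : star A ∈ trigSpan (Set.Ioc (-(N + N)) (-N)) :=
      star_mem_trigSpan memA (by simp; intros; constructor <;> linarith)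
    have memB' : star B ∈ trigSpan (Set.Ioc (-(3 * N + N)) (-(3 * N))) :=
      star_mem_trigSpan memB (by simp; intros; constructor <;> linarith)
    refine Submodule.smul_mem _ _ (add_mem (add_mem (add_mem ?_ ?_) (Submodule.smul_mem _ _ ?_))
      (Submodule.smul_mem _ _ ?_))
    · refine mul_mem_trigSpan memG memG fun a ⟨h1, h2⟩ b ⟨h3, h4⟩ => ?_
      rw [Set.mem_ofPred_eq, le_abs]
      left; linarith
    · refine mul_mem_trigSpan memG' memG' fun a ⟨h1, h2⟩ b ⟨h3, h4⟩ => ?_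
      rw [Set.mem_ofPred_eq, le_abs]
      right; linarith
    · refine mul_mem_trigSpan memB memA' fun a ⟨h1, h2⟩ b ⟨h3, h4⟩ => ?_
      rw [Set.mem_ofPred_eq, le_abs]
      left; linarith
    · refine mul_mem_trigSpan memA memB' fun a ⟨h1, h2⟩ b ⟨h3, h4⟩ => ?_
      rw [Set.mem_ofPred_eq, le_abs]
      right; linarith
  · rw [map_smul, norm_smul, nc, map_add]
    have h1 : ‖coeff n (star G)‖ ≤ 1 := by
      rw [coeff_star, RCLike.norm_conj]
      exact cG _
    calc 1 / (4 * s) * ‖coeff n G + coeff n (star G)‖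
        ≤ 1 / (4 * s) * (1 + 1) := by
          gcongr
          exact (norm_add_le _ _).trans (add_le_add (cG n) h1)
      _ ≤ 1 / s := by
          rw [← sub_nonneg]
          have : 1 / s - 1 / (4 * s) * (1 + 1) = 1 / (2 * s) := by field_simp; norm_num
          rw [this]
          positivity

section Singularity

variable {Ω : Type*} [MeasurableSpace Ω] {μ ν : Measure Ω}

lemma integral_sq_sum_le [IsProbabilityMeasure μ] {Y : ℕ → Ω → ℝ} {B : ℝ}
    (hY : ∀ j, Measurable (Y j)) (hB : ∀ j x, |Y j x| ≤ B)
    (horth : ∀ i j, i < j → ∫ x, Y i x * Y j x ∂μ = 0) (K : ℕ) :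
    Integrable (fun x => (∑ j ∈ Finset.range K, Y j x) ^ 2) μ ∧
      ∫ x, (∑ j ∈ Finset.range K, Y j x) ^ 2 ∂μ ≤ K * B ^ 2 := by
  have hint (i j : ℕ) : Integrable (fun x => Y i x * Y j x) μ := by
    refine .of_bound ((hY i).mul (hY j)).aestronglyMeasurable (B * B) (.of_forall fun x => ?_)
    rw [norm_mul]
    exact mul_le_mul (hB i x) (hB j x) (norm_nonneg _) ((abs_nonneg _).trans (hB i x))
  have hcross (L : ℕ) : Integrable (fun x => (∑ j ∈ Finset.range L, Y j x) * Y L x) μ := by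
    simp only [Finset.sum_mul]
    exact integrable_finsetSum _ fun i _ => hint i L
  have hsucc (L : ℕ) : (fun x => (∑ j ∈ Finset.range (L + 1), Y j x) ^ 2) = fun x =>
      (∑ j ∈ Finset.range L, Y j x) ^ 2 + 2 * ((∑ j ∈ Finset.range L, Y j x) * Y L x) +
        Y L x * Y L x := by
    ext x
    rw [Finset.sum_range_succ]
    ring
  induction K with
  | zero => simp
  | succ K ih =>
    rw [hsucc]
    have h2 := (hcross K).const_mul 2
    have h3 : Integrable (fun x => (∑ j ∈ Finset.range K, Y j x) ^ 2 +
        2 * ((∑ j ∈ Finset.range K, Y j x) * Y K x)) μ := ih.1.add h2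
    refine ⟨h3.add (hint K K), ?_⟩
    rw [integral_add h3 (hint K K), integral_add ih.1 h2, integral_const_mul]
    have h0 : ∫ x, (∑ j ∈ Finset.range K, Y j x) * Y K x ∂μ = 0 := by
      simp only [Finset.sum_mul]
      rw [integral_finsetSum _ fun i _ => hint i K]
      exact Finset.sum_eq_zero fun i hi => horth i K (Finset.mem_range.1 hi)
    have hd : ∫ x, Y K x * Y K x ∂μ ≤ B ^ 2 := by
      calc ∫ x, Y K x * Y K x ∂μ ≤ ∫ _, B ^ 2 ∂μ := by
            refine integral_mono (hint K K) (integrable_const _) fun x => ?_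
            have := hB K x
            have := abs_nonneg (Y K x)
            show Y K x * Y K x ≤ B ^ 2
            rw [← abs_mul_abs_self]
            nlinarith
        _ = B ^ 2 := by simp
    rw [h0]
    push_cast
    linarith [ih.2]

/-- If bounded functions are pairwise uncorrelated for two probability measures, with common
means that differ, the law of large numbers separates the measures. -/
lemma mutuallySingular_of_uncorrelated [IsProbabilityMeasure μ] [IsProbabilityMeasure ν]
    {X : ℕ → Ω → ℝ} (hX : ∀ j, Measurable (X j)) (hX1 : ∀ j x, |X j x| ≤ 1)
    {c : ℝ} (hc : c ≠ 0) (hν : ∀ i j, i < j → ∫ x, X i x * X j x ∂ν = 0)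
    (hμ : ∀ i j, i < j → ∫ x, (X i x - c) * (X j x - c) ∂μ = 0) : μ ⟂ₘ ν := by
  refine Measure.mutuallySingular_of_disjoint ?_
  intro ρ hρμ hρν
  have : IsFiniteMeasure ρ := isFiniteMeasure_of_le _ hρμ
  set D : ℝ := 2 + 2 * (1 + |c|) ^ 2 with hD
  have key (K : ℕ) : K * (c ^ 2 * ρ.real Set.univ) * K ≤ D * K := by
    obtain ⟨i1, b1⟩ := integral_sq_sum_le hX hX1 hν K
    obtain ⟨i2, b2⟩ := integral_sq_sum_le (Y := fun j x => X j x - c) (B := 1 + |c|)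
      (fun j => (hX j).sub_const c)
      (fun j x => (abs_sub _ _).trans (add_le_add_left (hX1 j x) _)) hμ K
    have c1 := integral_mono_measure hρν (.of_forall fun x => sq_nonneg _) i1
    have c2 := integral_mono_measure hρμ (.of_forall fun x => sq_nonneg _) i2
    have j1 := i1.mono_measure hρν
    have j2 := i2.mono_measure hρμ
    have : ∫ _, (K * c) ^ 2 ∂ρ ≤ ∫ x, (2 * (∑ j ∈ Finset.range K, X j x) ^ 2 +
        2 * (∑ j ∈ Finset.range K, (X j x - c)) ^ 2) ∂ρ := by
      refine integral_mono (integrable_const _) ((j1.const_mul 2).add (j2.const_mul 2))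
        fun x => ?_
      simp only [Finset.sum_sub_distrib, Finset.sum_const, Finset.card_range, nsmul_eq_mul]
      nlinarith [sq_nonneg (2 * ∑ j ∈ Finset.range K, X j x - K * c)]
    rw [integral_add (j1.const_mul 2) (j2.const_mul 2), integral_const_mul,
      integral_const_mul, integral_const, smul_eq_mul] at this
    simp only [hD]
    nlinarith
  have hle (K : ℕ) : K * (c ^ 2 * ρ.real Set.univ) ≤ D := by
    rcases K.eq_zero_or_pos with rfl | hK
    · simp
      positivity
    · exact le_of_mul_le_mul_right (key K) (by exact_mod_cast hK)
  have hzero : ρ.real Set.univ = 0 := by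
    by_contra h
    have hpos : 0 < c ^ 2 * ρ.real Set.univ := by positivity
    obtain ⟨K, hK⟩ := exists_nat_gt (D / (c ^ 2 * ρ.real Set.univ))
    rw [div_lt_iff₀ hpos] at hK
    exact (hle K).not_gt hK
  rw [Measure.real, ENNReal.toReal_eq_zero_iff] at hzero
  exact (Measure.measure_univ_eq_zero.1 (hzero.resolve_right (measure_ne_top _ _))).le

end Singularity

open scoped Nat

/-- The base frequency of the `k`-th block. -/
def freq (k : ℕ) : ℤ := 2 ^ (k + 4)!

/-- A bound for the degree of the `k`-th partial product. -/
def deg (k : ℕ) : ℤ := 2 ^ (2 * (k + 3)!)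

lemma deg_succ (k : ℕ) : deg (k + 1) = freq k ^ 2 := by
  rw [deg, freq, ← pow_mul, mul_comm]

lemma deg_pow (k : ℕ) : deg k ^ (k + 4) = freq k ^ 2 := by
  rw [deg, freq, ← pow_mul, ← pow_mul, Nat.factorial_succ (k + 3)]
  ring_nf

lemma one_le_deg (k : ℕ) : 1 ≤ deg k := one_le_pow₀ one_le_two

lemma freq_pos (k : ℕ) : 0 < freq k := by
  unfold freq
  positivity

lemma eight_mul_deg_le (k : ℕ) : 8 * deg k ≤ freq k := by
  have h : 3 + 2 * (k + 3)! ≤ (k + 4)! := by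
    rw [Nat.factorial_succ (k + 3)]
    have : 3 ≤ (k + 3)! := (by simp : 3 ≤ k + 3).trans (Nat.self_le_factorial _)
    nlinarith
  calc 8 * deg k = 2 ^ (3 + 2 * (k + 3)!) := by rw [pow_add, deg]; norm_num
    _ ≤ freq k := pow_le_pow_right₀ one_le_two h

lemma deg_add_le (k : ℕ) : deg k + 4 * freq k ≤ deg (k + 1) := by
  rw [deg_succ]
  nlinarith [eight_mul_deg_le k, one_le_deg k]

lemma deg_mono : Monotone deg := by
  refine monotone_nat_of_le_succ fun k => ?_
  linarith [deg_add_le k, freq_pos k]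

lemma four_mul_freq_le {i j : ℕ} (h : i < j) : 4 * freq i ≤ deg j := by
  have := deg_mono (Nat.succ_le_of_lt h)
  linarith [deg_add_le i, one_le_deg i]

lemma freq_mono : Monotone freq := by
  refine monotone_nat_of_le_succ fun k => ?_
  linarith [four_mul_freq_le k.lt_succ_self, eight_mul_deg_le (k + 1), one_le_deg (k + 1),
    freq_pos k]

/-- The `k`-th flat block. -/
noncomputable def block (k : ℕ) : C(𝕋, ℂ) := (exists_flat_block (k + 4)!).choose

lemma star_block (k : ℕ) : star (block k) = block k :=
  (exists_flat_block (k + 4)!).choose_spec.1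

lemma norm_block_le (k : ℕ) (x : 𝕋) : ‖block k x‖ ≤ 1 :=
  (exists_flat_block (k + 4)!).choose_spec.2.1 x

lemma block_mem (k : ℕ) : block k ∈ trigSpan {n | freq k ≤ |n| ∧ |n| ≤ 4 * freq k} :=
  (exists_flat_block (k + 4)!).choose_spec.2.2.1

lemma block_sq_mem (k : ℕ) :
    block k * block k - (1 / 4 : ℂ) • 1 ∈ trigSpan {n | freq k ≤ |n|} :=
  (exists_flat_block (k + 4)!).choose_spec.2.2.2.1

lemma norm_coeff_block_le (k : ℕ) (n : ℤ) : ‖coeff n (block k)‖ ≤ 1 / √(freq k) := by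
  simpa [freq, block] using (exists_flat_block (k + 4)!).choose_spec.2.2.2.2 n

lemma block_apply (k : ℕ) (x : 𝕋) : block k x = ((block k x).re : ℂ) := by
  have := congrArg (fun f : C(𝕋, ℂ) => f x) (star_block k)
  exact (Complex.conj_eq_iff_re.1 this).symm

lemma abs_re_block_le (k : ℕ) (x : 𝕋) : |(block k x).re| ≤ 1 :=
  (Complex.abs_re_le_norm _).trans (norm_block_le k x)

lemma block_mem_of_lt {i j : ℕ} (h : i < j) : block i ∈ trigSpan {n | |n| ≤ deg j} :=
  trigSpan_mono (fun _ hn => hn.2.trans (four_mul_freq_le h)) (block_mem i)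

/-- The partial products of the generalized Riesz product. -/
noncomputable def partialProd (k : ℕ) : C(𝕋, ℂ) := ∏ j ∈ Finset.range k, (1 + block j)

lemma partialProd_succ (k : ℕ) :
    partialProd (k + 1) = partialProd k + partialProd k * block k := by
  rw [partialProd, Finset.prod_range_succ, mul_add, mul_one, partialProd]

lemma mul_mem_trigSpan_abs {a b c : ℤ} (hf : f ∈ trigSpan {n | |n| ≤ a})
    (hg : g ∈ trigSpan {n | |n| ≤ b}) (h : a + b ≤ c) : f * g ∈ trigSpan {n | |n| ≤ c} :=
  mul_mem_trigSpan hf hg fun i hi j hj => (abs_add_le i j).trans ((add_le_add hi hj).trans h)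

lemma trigSpan_abs_mono {a b : ℤ} (hf : f ∈ trigSpan {n | |n| ≤ a}) (h : a ≤ b) :
    f ∈ trigSpan {n | |n| ≤ b} :=
  trigSpan_mono (fun _ hn => le_trans hn h) hf

lemma coeff_zero_mul_eq_zero_of_lt {a b : ℤ} (hf : f ∈ trigSpan {n | |n| ≤ a})
    (hg : g ∈ trigSpan {n | b ≤ |n|}) (h : a < b) : coeff 0 (f * g) = 0 := by
  refine coeff_zero_mul_eq_zero hf hg fun i hi j hj hij => ?_
  rw [eq_neg_of_add_eq_zero_left hij, Set.mem_ofPred_eq, abs_neg] at hi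
  exact absurd (le_trans hj hi) h.not_ge

lemma partialProd_mem (k : ℕ) : partialProd k ∈ trigSpan {n | |n| ≤ deg k} := by
  induction k with
  | zero => simpa [partialProd] using one_mem_trigSpan (by simp [deg])
  | succ k ih =>
    rw [partialProd_succ]
    refine add_mem (trigSpan_abs_mono ih (deg_mono k.le_succ))
      (mul_mem_trigSpan_abs ih ?_ (deg_add_le k))
    exact trigSpan_mono (fun _ hn => hn.2) (block_mem k)

lemma exists_nonneg_partialProd (k : ℕ) (x : 𝕋) : ∃ r : ℝ, 0 ≤ r ∧ partialProd k x = r := by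
  induction k with
  | zero => exact ⟨1, zero_le_one, by simp [partialProd]⟩
  | succ k ih =>
    obtain ⟨r, hr, h⟩ := ih
    refine ⟨r * (1 + (block k x).re), mul_nonneg hr ?_, ?_⟩
    · linarith [neg_le_of_abs_le (abs_re_block_le k x)]
    · rw [partialProd_succ, ContinuousMap.add_apply, ContinuousMap.mul_apply, h, block_apply k x]
      push_cast
      simp [mul_add]

lemma mul_partialProd_mem {k : ℕ} (hf : f ∈ trigSpan {n | |n| ≤ 2 * deg k}) :
    f * partialProd k ∈ trigSpan {n | |n| ≤ 3 * deg k} :=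
  mul_mem_trigSpan_abs hf (partialProd_mem k) (by linarith)

lemma coeff_zero_mul_partialProd_mul_block {k : ℕ} (hf : f ∈ trigSpan {n | |n| ≤ 2 * deg k}) :
    coeff 0 (f * partialProd k * block k) = 0 :=
  coeff_zero_mul_eq_zero_of_lt (mul_partialProd_mem hf)
    (trigSpan_mono (fun _ hn => hn.1) (block_mem k)) (by linarith [eight_mul_deg_le k, one_le_deg k])

lemma coeff_zero_mul_partialProd_mul_block_sq {k : ℕ}
    (hf : f ∈ trigSpan {n | |n| ≤ 2 * deg k}) :
    coeff 0 (f * partialProd k * (block k * block k)) = 1 / 4 * coeff 0 (f * partialProd k) := by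
  have := coeff_zero_mul_eq_zero_of_lt (mul_partialProd_mem hf) (block_sq_mem k)
    (by linarith [eight_mul_deg_le k, one_le_deg k])
  rw [mul_sub, map_sub, sub_eq_zero] at this
  rw [this, mul_smul_comm, mul_one, map_smul, smul_eq_mul]

lemma coeff_zero_mul_partialProd_of_le {k l : ℕ} (hf : f ∈ trigSpan {n | |n| ≤ 2 * deg k})
    (h : k ≤ l) : coeff 0 (f * partialProd l) = coeff 0 (f * partialProd k) := by
  induction l, h using Nat.le_induction with
  | base => rfl
  | succ l hl ih =>
    rw [partialProd_succ, mul_add, map_add, ← mul_assoc, coeff_zero_mul_partialProd_mul_block,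
      add_zero, ih]
    exact trigSpan_abs_mono hf (by linarith [deg_mono hl])

lemma one_mem_trigSpan_deg (k : ℕ) : (1 : C(𝕋, ℂ)) ∈ trigSpan {n | |n| ≤ 2 * deg k} :=
  one_mem_trigSpan (by
    rw [Set.mem_ofPred_eq, abs_zero]
    linarith [one_le_deg k])

lemma coeff_zero_partialProd (k : ℕ) : coeff 0 (partialProd k) = 1 := by
  have h := coeff_zero_mul_partialProd_of_le (one_mem_trigSpan_deg 0) k.zero_le
  simpa [partialProd, coeff_apply] using h

lemma coeff_zero_eq_integral (f : C(𝕋, ℂ)) : coeff 0 f = ∫ x, f x ∂haarAddCircle := by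
  simp [coeff_apply]

lemma coeff_eq_coeff_zero (n : ℤ) (f : C(𝕋, ℂ)) : coeff n f = coeff 0 (fourier (-n) * f) := by
  rw [coeff_fourier_mul, zero_sub, neg_neg]

lemma integrable_haar (f : C(𝕋, ℂ)) : Integrable f haarAddCircle :=
  f.continuous.integrable_of_hasCompactSupport (HasCompactSupport.of_compactSpace _)

lemma partialProd_apply (k : ℕ) (x : 𝕋) : partialProd k x = ((partialProd k x).re : ℂ) := by
  obtain ⟨r, -, h⟩ := exists_nonneg_partialProd k x
  simp [h]

lemma re_partialProd_nonneg (k : ℕ) (x : 𝕋) : 0 ≤ (partialProd k x).re := by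
  obtain ⟨r, hr, h⟩ := exists_nonneg_partialProd k x
  simpa [h] using hr

lemma integral_re_partialProd (k : ℕ) : ∫ x, (partialProd k x).re ∂haarAddCircle = 1 := by
  have := coeff_zero_partialProd k
  rw [coeff_zero_eq_integral] at this
  have h2 := integral_re (𝕜 := ℂ) (integrable_haar (partialProd k))
  simpa [this] using h2

lemma norm_coeff_partialProd_le (k : ℕ) (n : ℤ) : ‖coeff n (partialProd k)‖ ≤ 1 := by
  rw [coeff_apply]
  refine (norm_integral_le_integral_norm _).trans_eq (Eq.trans ?_ (integral_re_partialProd k))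
  congr 1 with x
  rw [ContinuousMap.mul_apply, norm_mul, partialProd_apply, Complex.norm_real,
    Real.norm_of_nonneg (re_partialProd_nonneg k x), fourier_apply, Circle.norm_coe, one_mul,
    Complex.ofReal_re]

/-- The measures whose densities are the partial products. -/
noncomputable def partialMeasure (k : ℕ) : Measure 𝕋 :=
  haarAddCircle.withDensity fun x => ENNReal.ofReal (partialProd k x).re

instance (k : ℕ) : IsProbabilityMeasure (partialMeasure k) := by
  constructor
  have h := ofReal_integral_eq_lintegral_ofReal (integrable_haar (partialProd k)).re
    (.of_forall (re_partialProd_nonneg k))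
  simp only [RCLike.re_to_complex, integral_re_partialProd, ENNReal.ofReal_one] at h
  rw [partialMeasure, withDensity_apply _ .univ, Measure.restrict_univ, ← h]

lemma integral_partialMeasure (k : ℕ) (f : C(𝕋, ℂ)) :
    ∫ x, f x ∂(partialMeasure k) = coeff 0 (f * partialProd k) := by
  rw [partialMeasure, integral_withDensity_eq_integral_toReal_smul (by fun_prop) (by simp),
    coeff_zero_eq_integral]
  congr 1 with x
  rw [ENNReal.toReal_ofReal (re_partialProd_nonneg k x), ContinuousMap.mul_apply,
    partialProd_apply k x, Complex.real_smul, mul_comm, Complex.ofReal_re]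

/-- The generalized Riesz product as a weak limit. -/
lemma exists_limit_measure : ∃ μ : Measure 𝕋, IsProbabilityMeasure μ ∧
    ∀ k, ∀ f ∈ trigSpan {n | |n| ≤ 2 * deg k}, ∫ x, f x ∂μ = coeff 0 (f * partialProd k) := by
  let ν : ℕ → ProbabilityMeasure 𝕋 := fun k => ⟨partialMeasure k, inferInstance⟩
  let F : Ultrafilter (ProbabilityMeasure 𝕋) := (hyperfilter ℕ).map ν
  have hF : Tendsto ν (hyperfilter ℕ) (nhds F.lim) := F.le_nhds_lim
  refine ⟨F.lim, inferInstance, fun k f hf => ?_⟩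
  have h1 := (ProbabilityMeasure.tendsto_iff_forall_integral_rclike_tendsto ℂ).1 hF
    (BoundedContinuousFunction.mkOfCompact f)
  refine tendsto_nhds_unique h1 (Tendsto.congr' ?_ tendsto_const_nhds)
  refine Nat.hyperfilter_le_atTop ((eventually_ge_atTop k).mono fun l hl => ?_)
  exact ((integral_partialMeasure l f).trans (coeff_zero_mul_partialProd_of_le hf hl)).symm

section Limit

variable {μ : Measure 𝕋}

lemma integral_block [IsProbabilityMeasure μ]
    (hμ : ∀ k, ∀ f ∈ trigSpan {n | |n| ≤ 2 * deg k}, ∫ x, f x ∂μ = coeff 0 (f * partialProd k))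
    {j : ℕ} (hf : f ∈ trigSpan {n | |n| ≤ deg j}) :
    ∫ x, f x * block j x ∂μ = 1 / 4 * ∫ x, f x ∂μ := by
  have hf2 : f ∈ trigSpan {n | |n| ≤ 2 * deg j} :=
    trigSpan_abs_mono hf (by linarith [one_le_deg j])
  have h := hμ (j + 1) (f * block j) (mul_mem_trigSpan_abs
    (trigSpan_abs_mono hf (deg_mono j.le_succ)) (block_mem_of_lt j.lt_succ_self) (two_mul _).ge)
  have e : f * block j * partialProd (j + 1) =
      f * partialProd j * block j + f * partialProd j * (block j * block j) := by
    rw [partialProd_succ]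
    ring
  rw [e, map_add, coeff_zero_mul_partialProd_mul_block hf2,
    coeff_zero_mul_partialProd_mul_block_sq hf2, zero_add, ← hμ j f hf2] at h
  exact h

lemma integral_re_block_mul [IsFiniteMeasure μ] (i j : ℕ) :
    ((∫ x, (block i x).re * (block j x).re ∂μ : ℝ) : ℂ) = ∫ x, block i x * block j x ∂μ := by
  rw [← integral_complex_ofReal]
  congr 1 with x
  rw [Complex.ofReal_mul, ← block_apply, ← block_apply]

lemma integral_re_block (j : ℕ) :
    ((∫ x, (block j x).re ∂μ : ℝ) : ℂ) = ∫ x, block j x ∂μ := by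
  rw [← integral_complex_ofReal]
  congr 1 with x
  rw [← block_apply]

lemma limit_mutuallySingular [IsProbabilityMeasure μ]
    (hμ : ∀ k, ∀ f ∈ trigSpan {n | |n| ≤ 2 * deg k},
      ∫ x, f x ∂μ = coeff 0 (f * partialProd k)) :
    μ ⟂ₘ haarAddCircle := by
  have hmean (j : ℕ) : ∫ x, (block j x).re ∂μ = 1 / 4 := by
    have h1 : (1 : C(𝕋, ℂ)) ∈ trigSpan {n | |n| ≤ deg j} :=
      one_mem_trigSpan (by
        rw [Set.mem_ofPred_eq, abs_zero]
        linarith [one_le_deg j])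
    have := integral_block hμ h1
    have h2 := integral_re_block (μ := μ) j
    simp at this
    rw [this] at h2
    exact_mod_cast h2.trans (by norm_num : (4⁻¹ : ℂ) = ((1 / 4 : ℝ) : ℂ))
  have hmul (i j : ℕ) (h : i < j) : ∫ x, (block i x).re * (block j x).re ∂μ = 1 / 16 := by
    have h1 := integral_block hμ (block_mem_of_lt h)
    rw [← integral_re_block_mul, ← integral_re_block, hmean] at h1
    have : ((∫ x, (block i x).re * (block j x).re ∂μ : ℝ) : ℂ) = ((1 / 16 : ℝ) : ℂ) := by
      rw [h1]
      norm_num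
    exact_mod_cast this
  have hint (i : ℕ) : Integrable (fun x => (block i x).re) μ := by
    refine .of_bound (by fun_prop) 1 (.of_forall (abs_re_block_le i))
  have hint2 (i j : ℕ) : Integrable (fun x => (block i x).re * (block j x).re) μ := by
    refine .of_bound (by fun_prop) 1 (.of_forall fun x => ?_)
    rw [norm_mul]
    exact mul_le_one₀ (abs_re_block_le i x) (norm_nonneg _) (abs_re_block_le j x)
  refine mutuallySingular_of_uncorrelated (X := fun j x => (block j x).re) (c := 1 / 4)
    (fun j => by fun_prop) abs_re_block_le (by norm_num) (fun i j h => ?_) fun i j h => ?_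
  · have h1 := coeff_zero_mul_eq_zero_of_lt (block_mem_of_lt h)
      (trigSpan_mono (fun _ hn => hn.1) (block_mem j))
      (by linarith [eight_mul_deg_le j, one_le_deg j])
    rw [coeff_zero_eq_integral] at h1
    have h2 := integral_re_block_mul (μ := haarAddCircle) i j
    simp only [ContinuousMap.mul_apply] at h1
    rw [h1] at h2
    exact_mod_cast h2
  · have h1 : Integrable (fun x => 1 / 4 * (block i x).re + 1 / 4 * (block j x).re) μ :=
      ((hint i).const_mul _).add ((hint j).const_mul _)
    have h2 : Integrable (fun x => (block i x).re * (block j x).re -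
        (1 / 4 * (block i x).re + 1 / 4 * (block j x).re)) μ := (hint2 i j).sub h1
    have e : (fun x => ((block i x).re - 1 / 4) * ((block j x).re - 1 / 4)) = fun x =>
        (block i x).re * (block j x).re - (1 / 4 * (block i x).re + 1 / 4 * (block j x).re)
          + 1 / 16 := by
      ext x
      ring
    rw [e, integral_add h2 (integrable_const _), integral_sub (hint2 i j) h1,
      integral_add ((hint i).const_mul _) ((hint j).const_mul _),
      integral_const_mul, integral_const_mul, hmean, hmean, hmul i j h]
    norm_num

end Limit

lemma norm_coeff_partialProd_mul_block_le (k : ℕ) (n : ℤ) :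
    ‖coeff n (partialProd k * block k)‖ ≤ 3 * deg k / √(freq k) := by
  have hmem : partialProd k ∈ trigSpan (Finset.Icc (-deg k) (deg k) : Finset ℤ) :=
    trigSpan_mono (fun n hn => by simpa [abs_le] using hn) (partialProd_mem k)
  have h := norm_coeff_mul_le _ hmem (norm_coeff_partialProd_le k) (norm_coeff_block_le k) n
  refine h.trans ?_
  rw [mul_one_div]
  gcongr
  have h1 := one_le_deg k
  have : ((Finset.Icc (-deg k) (deg k)).card : ℤ) ≤ 3 * deg k := by
    rw [Int.card_Icc, Int.toNat_of_nonneg (by linarith)]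
    linarith
  exact_mod_cast this

lemma exists_norm_coeff_partialProd_le (K : ℕ) {n : ℤ} (hn : n ≠ 0) :
    ∃ k, |n| ≤ 5 * freq k ∧ ‖coeff n (partialProd K)‖ ≤ 3 * deg k / √(freq k) := by
  induction K with
  | zero =>
    have h0 : coeff n (partialProd 0) = 0 := by
      rw [partialProd, Finset.prod_range_zero, ← fourier_zero_eq_one, coeff_fourier, if_neg hn.symm]
    refine ⟨n.natAbs, ?_, ?_⟩
    · have h1 : n.natAbs < 2 ^ (n.natAbs + 4)! := by
        refine lt_of_le_of_lt ?_ (Nat.lt_two_pow_self)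
        exact (Nat.le_add_right _ 4).trans (Nat.self_le_factorial _)
      have h2 : |n| < freq n.natAbs := by
        rw [Int.abs_eq_natAbs, freq]
        exact_mod_cast h1
      linarith [freq_pos n.natAbs]
    · rw [h0, norm_zero]
      have : (0 : ℝ) ≤ deg n.natAbs := by exact_mod_cast zero_le_one.trans (one_le_deg _)
      positivity
  | succ K ih =>
    rw [partialProd_succ, map_add]
    by_cases h : |n| ≤ deg K
    · have : coeff n (partialProd K * block K) = 0 := by
        rw [coeff_eq_coeff_zero, ← mul_assoc]
        refine coeff_zero_mul_partialProd_mul_block (fourier_mem_trigSpan ?_)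
        rw [Set.mem_ofPred_eq, abs_neg]
        linarith [one_le_deg K]
      rwa [this, add_zero]
    · have h0 := coeff_eq_zero_of_mem_trigSpan (partialProd_mem K) h
      rw [h0, zero_add]
      by_cases h2 : |n| ≤ 5 * freq K
      · exact ⟨K, h2, norm_coeff_partialProd_mul_block_le K n⟩
      · have : coeff n (partialProd K * block K) = 0 := by
          have hm := mul_mem_trigSpan_abs (partialProd_mem K)
            (trigSpan_mono (fun _ hn => hn.2) (block_mem K)) le_rfl
          refine coeff_eq_zero_of_mem_trigSpan hm fun hn => h2 ?_
          rw [Set.mem_ofPred_eq] at hn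
          linarith [eight_mul_deg_le K, one_le_deg K]
        rwa [this, ← h0]

lemma deg_le_rpow {ε : ℝ} {k : ℕ} (h : 2 / ε ≤ k) (hε : 0 < ε) :
    (deg k : ℝ) ≤ (freq k : ℝ) ^ ε := by
  have hf : (1 : ℝ) ≤ freq k := by exact_mod_cast freq_pos k
  have hd : (0 : ℝ) ≤ deg k := by exact_mod_cast zero_le_one.trans (one_le_deg k)
  have h1 : (deg k : ℝ) ^ (k + 4) = (freq k : ℝ) ^ 2 := by exact_mod_cast deg_pow k
  refine le_of_pow_le_pow_left₀ (n := k + 4) (by simp) (by positivity) ?_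
  rw [h1, ← Real.rpow_natCast _ 2, ← Real.rpow_mul_natCast (by linarith)]
  refine Real.rpow_le_rpow_of_exponent_le hf ?_
  rw [div_le_iff₀ hε] at h
  push_cast
  nlinarith

lemma isBigO_of_forall_exists {u : ℤ → ℂ}
    (hu : ∀ n ≠ 0, ∃ k, |n| ≤ 5 * freq k ∧ ‖u n‖ ≤ 3 * deg k / √(freq k))
    {ε : ℝ} (hε : 0 < ε) :
    u =O[cofinite] fun n : ℤ => (|n| : ℝ) ^ (-(1 / 2 : ℝ) + ε) := by
  set δ := min ε (1 / 2) with hδ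
  have hδ0 : 0 < δ := lt_min hε (by norm_num)
  obtain ⟨k₀, hk₀⟩ := exists_nat_ge (2 / δ)
  have hfin : {n : ℤ | |n| ≤ 5 * freq k₀}.Finite :=
    (Set.finite_Icc (-(5 * freq k₀)) (5 * freq k₀)).subset fun n hn => abs_le.1 hn
  refine IsBigO.of_bound 15 ?_
  filter_upwards [hfin.compl_mem_cofinite] with n hn
  have hn' : 5 * freq k₀ < |n| := not_le.1 hn
  have hn0 : n ≠ 0 := by
    rintro rfl
    rw [abs_zero] at hn'
    linarith [freq_pos k₀]
  obtain ⟨k, hk, hle⟩ := hu n hn0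
  have hkk : k₀ ≤ k := by
    by_contra! h
    linarith [freq_mono h.le]
  have hdeg := deg_le_rpow (hk₀.trans (by exact_mod_cast hkk)) hδ0
  have hf : (0 : ℝ) < freq k := by exact_mod_cast freq_pos k
  have habs : (1 : ℝ) ≤ |(n : ℝ)| := by exact_mod_cast Int.one_le_abs hn0
  have hk' : |(n : ℝ)| / 5 ≤ freq k := by
    rw [div_le_iff₀ (by norm_num)]
    have : ((|n| : ℤ) : ℝ) ≤ ((5 * freq k : ℤ) : ℝ) := by exact_mod_cast hk
    push_cast at this
    linarith
  have hexp : -(1 / 2 : ℝ) + δ ≤ 0 := by linarith [min_le_right ε (1 / 2)]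
  rw [Real.norm_of_nonneg (by positivity)]
  calc ‖u n‖ ≤ 3 * deg k / √(freq k) := hle
    _ ≤ 3 * (freq k : ℝ) ^ δ / √(freq k) := by gcongr
    _ = 3 * (freq k : ℝ) ^ (-(1 / 2 : ℝ) + δ) := by
      rw [Real.sqrt_eq_rpow, mul_div_assoc, ← Real.rpow_sub hf]
      ring_nf
    _ ≤ 3 * (|(n : ℝ)| / 5) ^ (-(1 / 2 : ℝ) + δ) := by
      gcongr 3 * ?_
      exact Real.rpow_le_rpow_of_nonpos (by positivity) hk' hexp
    _ = 3 * (5 : ℝ) ^ (1 / 2 - δ) * |(n : ℝ)| ^ (-(1 / 2 : ℝ) + δ) := by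
      rw [Real.div_rpow (by positivity) (by norm_num), div_eq_mul_inv,
        ← Real.rpow_neg (by norm_num)]
      ring_nf
    _ ≤ 3 * (5 : ℝ) ^ (1 : ℝ) * |(n : ℝ)| ^ (-(1 / 2 : ℝ) + ε) := by
      gcongr
      · norm_num
      · linarith
      · exact min_le_left _ _
    _ = 15 * |(n : ℝ)| ^ (-(1 / 2 : ℝ) + ε) := by norm_num

/-- The representative in `[0, 1)` of a point of the circle. -/
noncomputable def toIco (x : 𝕋) : ℝ := AddCircle.equivIco 1 0 x

lemma measurable_toIco : Measurable toIco :=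
  measurable_subtype_coe.comp (AddCircle.measurableEquivIco 1 0).measurable

lemma toIco_mem (x : 𝕋) : toIco x ∈ Set.Ico (0 : ℝ) 1 := by
  simpa [toIco] using (AddCircle.equivIco (1 : ℝ) 0 x).2

lemma coe_toIco (x : 𝕋) : (toIco x : 𝕋) = x := AddCircle.coe_equivIco

lemma map_toIco_mutuallySingular {μ : Measure 𝕋} (h : μ ⟂ₘ haarAddCircle) :
    μ.map toIco ⟂ₘ volume.restrict (Set.Ico (0 : ℝ) 1) := by
  obtain ⟨s, hs, h1, h2⟩ := h
  have hmeas : Measurable ((↑) : ℝ → 𝕋) := AddCircle.measurable_mk'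
  refine ⟨((↑) : ℝ → 𝕋) ⁻¹' s, hmeas hs, ?_, ?_⟩
  · rw [Measure.map_apply measurable_toIco (hmeas hs), ← Set.preimage_comp]
    simpa [Function.comp_def, coe_toIco] using h1
  · have hp := AddCircle.measurePreserving_mk (1 : ℝ) 0
    rw [zero_add] at hp
    rw [restrict_Ico_eq_restrict_Ioc, ← Set.preimage_compl,
      hp.measure_preimage hs.compl.nullMeasurableSet,
      volume_eq_smul_haarAddCircle]
    simp [h2]

end SchaefferSalem

open SchaefferSalem in
lemma fourierCoeffM_map_toIco (μ : Measure (AddCircle (1 : ℝ))) (n : ℤ) :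
    fourierCoeffM (μ.map toIco) n = ∫ x, fourier (-n) x ∂μ := by
  rw [fourierCoeffM, integral_map measurable_toIco.aemeasurable (by fun_prop)]
  congr 1 with x
  conv_rhs => rw [← coe_toIco x]
  rw [fourier_coe_apply]
  congr 1
  push_cast
  ring

open SchaefferSalem in
/-- There exists a probability Borel measure `σ` on `[0,1)` mutually singular with
Lebesgue measure and satisfying `σ̂(n) = O(|n|^{-1/2+ε})` for every `ε > 0`:
a Schaeffer–Salem measure. -/
theorem stmt_16 :
    ∃ σ : Measure ℝ, IsProbabilityMeasure σ ∧
      σ (Set.Ico (0:ℝ) 1)ᶜ = 0 ∧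
      σ ⟂ₘ (MeasureTheory.volume.restrict (Set.Ico (0:ℝ) 1)) ∧
      ∀ ε : ℝ, 0 < ε →
        (fun n : ℤ => fourierCoeffM σ n) =O[cofinite]
          (fun n : ℤ => (|n| : ℝ) ^ (-(1/2 : ℝ) + ε)) := by
  obtain ⟨μ, hμ, hlim⟩ := exists_limit_measure
  refine ⟨μ.map toIco, Measure.isProbabilityMeasure_map measurable_toIco.aemeasurable, ?_,
    map_toIco_mutuallySingular (limit_mutuallySingular hlim), fun ε hε => ?_⟩
  · rw [Measure.map_apply measurable_toIco measurableSet_Ico.compl]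
    convert measure_empty (μ := μ)
    ext x
    simpa using toIco_mem x
  · refine isBigO_of_forall_exists (fun n hn => ?_) hε
    have hK : |n| ≤ 2 * deg n.natAbs := by
      have h1 : n.natAbs < 2 ^ (2 * (n.natAbs + 3).factorial) := by
        refine lt_of_le_of_lt ?_ Nat.lt_two_pow_self
        have := Nat.self_le_factorial (n.natAbs + 3)
        omega
      have h2 : |n| < deg n.natAbs := by
        rw [Int.abs_eq_natAbs, deg]
        exact_mod_cast h1
      linarith [one_le_deg n.natAbs]
    rw [fourierCoeffM_map_toIco, hlim n.natAbs _ (fourier_mem_trigSpan (by simpa using hK)),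
      ← coeff_eq_coeff_zero]
    exact exists_norm_coeff_partialProd_le _ hn
end
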